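/- Let k ≥ 3 be an integer and 0 < δ ≤ 1. There exists a constant c(k, δ) > 0 such that: if M = M(N) is a prime number tending to infinity with the parameter N, ν = ν_N : Z_M → ℝ≥0 is a k-pseudorandom measure, and f = f_N : Z_M → ℝ satisfies 0 ≤ f(x) ≤ ν(x) for all x ∈ Z_M and E(f) ≥ δ for all N, then liminf_{N→∞} E( f(x)·f(x+r)·…·f(x+(k−1)r) | x, r ∈ Z_M ) ≥ c(k, δ). -/

import Mathlib

open Finset Filter
open scoped Classical

noncomputable section

/-- `ε_k := 1/(2^k (k+4)!)`. -/
def epsk (k : ℕ) : ℝ := 1 / (2 ^ k * (Nat.factorial (k + 4)))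

/-- `W(N) := ∏_{p ≤ w(N)} p`. -/
def Wprim (w : ℕ → ℕ) (N : ℕ) : ℕ := ∏ p ∈ (Finset.range (w N + 1)).filter Nat.Prime, p

/-- W-tricked von Mangoldt function. -/
def tildeLambda (W n : ℕ) : ℝ :=
  if Nat.Prime (W * n + 1) then (Nat.totient W : ℝ) / W * Real.log (W * n + 1) else 0

/-- truncated divisor sum `Λ_R`. -/
def LambdaR (R : ℝ) (n : ℕ) : ℝ :=
  ∑ d ∈ n.divisors.filter (fun d : ℕ => (d : ℝ) ≤ R),
    ((ArithmeticFunction.moebius d : ℤ) : ℝ) * Real.log (R / (d : ℝ))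

/-- the representative of `n : ZMod m` lying in `[N, N+m)`. -/
def reprN (N : ℕ) {m : ℕ} (n : ZMod m) : ℕ := N + (n - (N : ZMod m)).val

/-- the condition `ε_k M ≤ n - N ≤ 2 ε_k M` on the representative in `[N, N+m)`. -/
def inWindow (k N : ℕ) {m : ℕ} (n : ZMod m) : Prop :=
  epsk k * m ≤ ((n - (N : ZMod m)).val : ℝ) ∧ ((n - (N : ZMod m)).val : ℝ) ≤ 2 * epsk k * m

/-- `R := M^(1/(k 2^(k+4)))`. -/
def Rpar (k m : ℕ) : ℝ := (m : ℝ) ^ ((1 : ℝ) / (k * 2 ^ (k + 4)))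

/-- the Green–Tao majorant `ν`. -/
def nuGT (k N W : ℕ) {m : ℕ} (n : ZMod m) : ℝ :=
  if inWindow k N n then
    (Nat.totient W : ℝ) / W * (LambdaR (Rpar k m) (W * reprN N n + 1)) ^ 2 / Real.log (Rpar k m)
  else 1

/-- the function `f`. -/
def fGT (k N W : ℕ) {m : ℕ} (n : ZMod m) : ℝ :=
  if inWindow k N n then tildeLambda W (reprN N n) / (k * 2 ^ (k + 5)) else 0

/-- the set of integers `n` with `ε_k M ≤ n - N ≤ 2 ε_k M`. -/
def windowSet (k N m : ℕ) : Finset ℕ :=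
  (Finset.range (N + m + 1)).filter
    (fun n => epsk k * m ≤ (n : ℝ) - N ∧ (n : ℝ) - N ≤ 2 * epsk k * m)

/-- `E(Λ̃(n) | ε_k M ≤ n - N ≤ 2 ε_k M)`. -/
def avgWindow (k N m W : ℕ) : ℝ :=
  (∑ n ∈ windowSet k N m, tildeLambda W n) / (windowSet k N m).card

/-- `E(g(x) | x ∈ Z_m)`. -/
def avgZ (m : ℕ) (g : ZMod m → ℝ) : ℝ := (∑ x ∈ Finset.range m, g (x : ZMod m)) / m

/-- `E(g(x) g(x+r) ⋯ g(x+(k-1)r) | x, r ∈ Z_m)`. -/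
def apAvg (k m : ℕ) (g : ZMod m → ℝ) : ℝ :=
  (∑ x ∈ Finset.range m, ∑ r ∈ Finset.range m,
    ∏ i ∈ Finset.range k, g ((x : ZMod m) + (i : ZMod m) * (r : ZMod m))) / (m : ℝ) ^ 2

/-- a rational number interpreted in `ZMod m`. -/
def ratZMod (q : ℚ) (m : ℕ) : ZMod m := (q.num : ZMod m) * (q.den : ZMod m)⁻¹

/-- the `(m₀,t₀,L₀)`-linear forms condition for a family `ν = ν_N : Z_{M(N)} → ℝ`. -/
def LinearFormsCondition (M : ℕ → ℕ) (ν : ∀ N : ℕ, ZMod (M N) → ℝ) (m₀ t₀ L₀ : ℕ) : Prop :=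
  ∀ m t : ℕ, m ≤ m₀ → t ≤ t₀ →
    ∀ L : Fin m → Fin t → ℚ,
      (∀ i j, (L i j).num.natAbs ≤ L₀ ∧ (L i j).den ≤ L₀) →
      (∀ i, L i ≠ 0) →
      (∀ i i', i ≠ i' → ∀ q : ℚ, L i ≠ q • L i') →
      ∀ δ : ℝ, 0 < δ → ∃ N₀ : ℕ, ∀ N ≥ N₀, L₀ < M N →
        ∀ b : Fin m → ZMod (M N),
          |(∑ x : Fin t → Fin (M N), ∏ i : Fin m,
              ν N (∑ j : Fin t, ratZMod (L i j) (M N) * ((x j : ℕ) : ZMod (M N)) + b i)) /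
              (M N : ℝ) ^ t - 1| ≤ δ

/-- the `m₀`-correlation condition for a family `ν = ν_N : Z_{M(N)} → ℝ`. -/
def CorrelationCondition (M : ℕ → ℕ) (ν : ∀ N : ℕ, ZMod (M N) → ℝ) (m₀ : ℕ) : Prop :=
  ∀ m : ℕ, 1 < m → m ≤ m₀ →
    ∃ τ : ∀ N : ℕ, ZMod (M N) → ℝ,
      (∀ N n, 0 ≤ τ N n) ∧
      (∀ q : ℝ, 1 ≤ q → ∃ C : ℝ, ∀ N, avgZ (M N) (fun n => τ N n ^ q) ≤ C) ∧
      (∀ N : ℕ, ∀ h : Fin m → ZMod (M N),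
        avgZ (M N) (fun x => ∏ i, ν N (x + h i)) ≤
          ∑ i : Fin m, ∑ j : Fin m, if i < j then τ N (h i - h j) else 0)

/-- `k`-pseudorandom measure. -/
def Pseudorandom (k : ℕ) (M : ℕ → ℕ) (ν : ∀ N : ℕ, ZMod (M N) → ℝ) : Prop :=
  (∀ δ : ℝ, 0 < δ → ∃ N₀, ∀ N ≥ N₀, |avgZ (M N) (ν N) - 1| ≤ δ) ∧
  LinearFormsCondition M ν (k * 2 ^ (k - 1)) (3 * k - 4) k ∧
  CorrelationCondition M ν (2 ^ (k - 1))

namespace RelSz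

set_option linter.unusedSectionVars false

open Combinatorics
open scoped BigOperators

/-- The indicator of a proposition. -/
def ind (p : Prop) : ℝ := if p then 1 else 0

lemma ind_true {p : Prop} (h : p) : ind p = 1 := if_pos h

lemma ind_false {p : Prop} (h : ¬p) : ind p = 0 := if_neg h

lemma ind_nonneg (p : Prop) : 0 ≤ ind p := by unfold ind; split_ifs <;> norm_num

lemma ind_le_one (p : Prop) : ind p ≤ 1 := by unfold ind; split_ifs <;> norm_num

lemma ind_mono {p q : Prop} (h : p → q) : ind p ≤ ind q := by
  by_cases hp : p
  · rw [ind_true hp, ind_true (h hp)]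
  · rw [ind_false hp]; exact ind_nonneg q

/-- The density of a subset of a finite type. -/
def den {X : Type*} [Fintype X] (A : Set X) : ℝ := 𝔼 x, ind (x ∈ A)

lemma den_nonneg {X : Type*} [Fintype X] (A : Set X) : 0 ≤ den A :=
  expect_nonneg fun _ _ => ind_nonneg _

lemma den_le_one {X : Type*} [Fintype X] (A : Set X) : den A ≤ 1 := by
  rcases isEmpty_or_nonempty X with h | h
  · simp [den]
  · exact expect_le univ_nonempty fun _ _ => ind_le_one _

lemma den_mono {X : Type*} [Fintype X] {A B : Set X} (h : A ⊆ B) : den A ≤ den B :=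
  expect_le_expect fun _ _ => ind_mono fun hx => h hx

lemma nonempty_of_den_pos {X : Type*} [Fintype X] {A : Set X} (h : 0 < den A) : A.Nonempty := by
  by_contra hA
  rw [Set.not_nonempty_iff_eq_empty] at hA
  simp [den, hA, ind] at h

lemma expect_le_den_add {X : Type*} [Fintype X] [Nonempty X] {F : X → ℝ} (hF : ∀ x, F x ≤ 1)
    {c : ℝ} (hc : 0 ≤ c) : 𝔼 x, F x ≤ den {x | c ≤ F x} + c := by
  have : 𝔼 x, F x ≤ 𝔼 x, (ind (x ∈ {x | c ≤ F x}) + c) := by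
    refine expect_le_expect fun x _ => ?_
    by_cases hx : c ≤ F x
    · rw [ind_true (show x ∈ {x | c ≤ F x} from hx)]; linarith [hF x]
    · rw [ind_false (show ¬ x ∈ {x | c ≤ F x} from hx)]; linarith [not_le.1 hx]
  rwa [expect_add_distrib, Fintype.expect_const] at this

/-- Some combinatorial line lies in `A`. -/
def HasLine {α ι : Type*} (A : Set (ι → α)) : Prop := ∃ l : Line α ι, ∀ a, l a ∈ A

/-- In large dimension, sets of density at least `δ` contain combinatorial lines. -/
def DHJAt (α : Type) [Fintype α] (δ : ℝ) : Prop :=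
  ∃ n : ℕ, ∀ (ι : Type) [Fintype ι] [DecidableEq ι], n ≤ Fintype.card ι →
    ∀ A : Set (ι → α), δ ≤ den A → HasLine A

/-- If a random member of a family of sets is dense on average, then a positive proportion of the
family contains a common line. -/
lemma exists_common_line {α ι Y : Type*} [Fintype α] [Fintype ι] [DecidableEq ι] [Fintype Y]
    {δ : ℝ} (hδ : 0 < δ) (h : ∀ A : Set (ι → α), δ / 2 ≤ den A → HasLine A)
    (A : Y → Set (ι → α)) (hA : δ ≤ 𝔼 y, den (A y)) :
    ∃ l : Line α ι, δ / 2 / Fintype.card (ι → Option α) ≤ den {y | ∀ a, l a ∈ A y} := by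
  have hY : Nonempty Y := by
    by_contra hY
    rw [not_nonempty_iff] at hY
    simp at hA; linarith
  have h1 := expect_le_den_add (F := fun y => den (A y)) (fun y => den_le_one _)
    (c := δ / 2) (by linarith)
  let R : (ι → Option α) → Set Y := fun w =>
    {y | (∃ i, w i = none) ∧ ∀ a, (fun i => (w i).getD a) ∈ A y}
  have h2 : δ / 2 ≤ ∑ w, den (R w) := by
    have : den {y | δ / 2 ≤ den (A y)} ≤ ∑ w, den (R w) := by
      generalize hD : {y | δ / 2 ≤ den (A y)} = D
      unfold den
      rw [← expect_sum_comm]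
      refine expect_le_expect fun y _ => ?_
      by_cases hy : y ∈ D
      · obtain ⟨l, hl⟩ := h (A y) (by rw [← hD] at hy; exact hy)
        have : y ∈ R l.idxFun := ⟨l.proper, hl⟩
        rw [ind_true hy]
        calc (1 : ℝ) = ind (y ∈ R l.idxFun) := (ind_true this).symm
          _ ≤ _ := single_le_sum (f := fun w => ind (y ∈ R w))
              (fun w _ => ind_nonneg _) (mem_univ _)
      · rw [ind_false hy]
        exact sum_nonneg fun w _ => ind_nonneg _
    linarith
  have hne : Nonempty (ι → Option α) := ⟨fun _ => none⟩
  have hc : (0 : ℝ) < Fintype.card (ι → Option α) := by exact_mod_cast Fintype.card_pos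
  obtain ⟨w, -, hw⟩ := exists_le_of_sum_le (s := univ)
    (f := fun _ : ι → Option α => δ / 2 / Fintype.card (ι → Option α)) (g := fun w => den (R w))
    univ_nonempty (by
      rw [sum_const, card_univ, nsmul_eq_mul, mul_div_cancel₀ _ hc.ne']; exact h2)
  have hpos : 0 < den (R w) := lt_of_lt_of_le (by positivity) hw
  obtain ⟨y, hy, -⟩ := nonempty_of_den_pos hpos
  exact ⟨⟨w, hy⟩, hw.trans (den_mono fun y hy => hy.2)⟩

section Join

variable {α ι κ μ : Type*}

/-- Glue two words along an identification of the coordinates. -/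
def join (e : κ ⊕ μ ≃ ι) (u : κ → α) (v : μ → α) : ι → α := fun i => Sum.elim u v (e.symm i)

lemma expect_join [Fintype α] [Fintype ι] [Fintype κ] [Fintype μ] [DecidableEq ι]
    [DecidableEq κ] [DecidableEq μ] (e : κ ⊕ μ ≃ ι) (F : (ι → α) → ℝ) :
    𝔼 x, F x = 𝔼 u, 𝔼 v, F (join e u v) := by
  rw [← expect_product' univ univ (fun u v => F (join e u v)), univ_product_univ]
  refine Fintype.expect_equiv ((Equiv.arrowCongr e.symm (Equiv.refl α)).trans
    (Equiv.sumArrowEquivProdArrow κ μ α)) _ _ fun x => ?_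
  congr 1
  funext i
  simp only [join, Equiv.trans_apply]
  rcases h : e.symm i with j | j
  · simp [Equiv.sumArrowEquivProdArrow, Equiv.arrowCongr, ← h]
  · simp [Equiv.sumArrowEquivProdArrow, Equiv.arrowCongr, ← h]

lemma expect_join' [Fintype α] [Fintype ι] [Fintype κ] [Fintype μ] [DecidableEq ι]
    [DecidableEq κ] [DecidableEq μ] (e : κ ⊕ μ ≃ ι) (F : (ι → α) → ℝ) :
    𝔼 x, F x = 𝔼 v, 𝔼 u, F (join e u v) := by
  rw [expect_join e, expect_comm]

lemma exists_split [Fintype ι] {a : ℕ} (h : a ≤ Fintype.card ι) :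
    Nonempty (Fin a ⊕ Fin (Fintype.card ι - a) ≃ ι) :=
  ⟨Fintype.equivOfCardEq (by simp; omega)⟩

/-- A subspace of the second block, with the first block held constant. -/
def Subspace.constLeft {η : Type*} (e : κ ⊕ μ ≃ ι) (u : κ → α) (T : Subspace η α μ) :
    Subspace η α ι where
  idxFun i := Sum.elim (fun p => Sum.inl (u p)) T.idxFun (e.symm i)
  proper z := by
    obtain ⟨i, hi⟩ := T.proper z
    exact ⟨e (Sum.inr i), by simp [hi]⟩

lemma Subspace.constLeft_apply {η : Type*} (e : κ ⊕ μ ≃ ι) (u : κ → α) (T : Subspace η α μ)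
    (z : η → α) : Subspace.constLeft e u T z = join e u (T z) := by
  funext i
  rcases h : e.symm i with j | j <;>
    simp [Combinatorics.Subspace.apply_def, Subspace.constLeft, join, h]

/-- A subspace of the first block, with the second block held constant. -/
def Subspace.constRight {η : Type*} (e : κ ⊕ μ ≃ ι) (T : Subspace η α κ) (v : μ → α) :
    Subspace η α ι where
  idxFun i := Sum.elim T.idxFun (fun p => Sum.inl (v p)) (e.symm i)
  proper z := by
    obtain ⟨i, hi⟩ := T.proper z
    exact ⟨e (Sum.inl i), by simp [hi]⟩

lemma Subspace.constRight_apply {η : Type*} (e : κ ⊕ μ ≃ ι) (T : Subspace η α κ) (v : μ → α)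
    (z : η → α) : Subspace.constRight e T v z = join e (T z) v := by
  funext i
  rcases h : e.symm i with j | j <;>
    simp [Combinatorics.Subspace.apply_def, Subspace.constRight, join, h]

end Join

/-- The multidimensional density Hales–Jewett theorem follows from the one-dimensional one. -/
lemma exists_subspace {α : Type} [Fintype α] (hα : ∀ δ : ℝ, 0 < δ → DHJAt α δ) (r : ℕ) :
    ∀ δ : ℝ, 0 < δ → ∃ n : ℕ, ∀ (ι : Type) [Fintype ι] [DecidableEq ι], n ≤ Fintype.card ι →
      ∀ A : Set (ι → α), δ ≤ den A → ∃ T : Subspace (Fin r) α ι, ∀ z, T z ∈ A := by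
  induction r with
  | zero =>
    intro δ hδ
    refine ⟨0, fun ι _ _ _ A hA => ?_⟩
    obtain ⟨x, hx⟩ := nonempty_of_den_pos (hδ.trans_le hA)
    refine ⟨⟨fun i => Sum.inl (x i), fun e => e.elim0⟩, fun z => ?_⟩
    have : (⟨fun i => Sum.inl (x i), fun e => e.elim0⟩ : Subspace (Fin 0) α ι) z = x := by
      funext i
      simp [Combinatorics.Subspace.apply_def]
    rwa [this]
  | succ r ih =>
    intro δ hδ
    obtain ⟨n₁, hn₁⟩ := hα (δ / 2) (by linarith)
    have hc : (0 : ℝ) < Fintype.card (Fin n₁ → Option α) := by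
      have : Nonempty (Fin n₁ → Option α) := ⟨fun _ => none⟩
      exact_mod_cast Fintype.card_pos
    obtain ⟨n₂, hn₂⟩ := ih (δ / 2 / Fintype.card (Fin n₁ → Option α)) (by positivity)
    refine ⟨n₁ + n₂, fun ι _ _ hι A hA => ?_⟩
    obtain ⟨e⟩ := exists_split (a := n₁) (ι := ι) (by omega)
    have hA' : δ ≤ 𝔼 y, den {u | join e u y ∈ A} := by
      refine hA.trans_eq ?_
      exact expect_join' e _
    obtain ⟨l, hl⟩ := exists_common_line hδ (hn₁ (Fin n₁) (by simp)) _ hA'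
    obtain ⟨T, hT⟩ := hn₂ _ (by simp; omega) _ hl
    refine ⟨⟨fun i => Sum.elim (fun p => (l.idxFun p).elim (Sum.inr 0) Sum.inl)
      (fun q => Sum.elim Sum.inl (fun j => Sum.inr j.succ) (T.idxFun q)) (e.symm i), ?_⟩, ?_⟩
    · intro j
      refine Fin.cases ?_ (fun j => ?_) j
      · obtain ⟨i, hi⟩ := l.proper
        exact ⟨e (Sum.inl i), by simp [hi]⟩
      · obtain ⟨i, hi⟩ := T.proper j
        exact ⟨e (Sum.inr i), by simp [hi]⟩
    · intro z
      have key := hT (fun j => z j.succ) (z 0)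
      change join e _ _ ∈ A at key
      convert key
      funext i
      rcases h : e.symm i with j | j
      · rcases h' : l.idxFun j with _ | a <;>
          simp [Combinatorics.Subspace.apply_def, join, h, h']
      · rcases h' : T.idxFun j with a | a <;>
          simp [Combinatorics.Subspace.apply_def, join, h, h']

/-- A subspace over `α`, viewed as a subspace over the enlarged alphabet `Option α`. -/
def Subspace.bump {η α ι : Type*} (T : Subspace η α ι) : Subspace η (Option α) ι where
  idxFun i := (T.idxFun i).map some id
  proper e := by
    obtain ⟨i, hi⟩ := T.proper e
    exact ⟨i, by simp [hi]⟩

lemma Subspace.bump_apply_inl {η α ι : Type*} (T : Subspace η α ι) (z : η → Option α) {i : ι}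
    {a : α} (h : T.idxFun i = Sum.inl a) : Subspace.bump T z i = some a := by
  simp [Combinatorics.Subspace.apply_def, Subspace.bump, h]

lemma Subspace.bump_apply_inr {η α ι : Type*} (T : Subspace η α ι) (z : η → Option α) {i : ι}
    {e : η} (h : T.idxFun i = Sum.inr e) : Subspace.bump T z i = z e := by
  simp [Combinatorics.Subspace.apply_def, Subspace.bump, h]

/-- A Ramsey statement: the colour of a word of a suitable subspace does not depend on its last
block as soon as the first block contains the letter `none`. -/
lemma exists_subspace_color {α κ : Type} [Finite α] [Fintype κ] (m : ℕ) :
    ∀ (C : Type) [Finite C], ∃ (ι : Type) (_ : Fintype ι), ∀ c : (ι → Option α) → C,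
      ∃ T : Subspace (Fin m ⊕ κ) α ι, ∀ z : Fin m → Option α, (∃ j, z j = none) →
        ∀ v v', c (Subspace.bump T (Sum.elim z v)) = c (Subspace.bump T (Sum.elim z v')) := by
  induction m with
  | zero =>
    intro C _
    refine ⟨κ, inferInstance, fun c => ⟨⟨fun i => Sum.inr (Sum.inr i), ?_⟩, ?_⟩⟩
    · rintro (e | e)
      · exact e.elim0
      · exact ⟨e, rfl⟩
    · rintro z ⟨j, -⟩
      exact j.elim0
  | succ m ih =>
    intro C _
    obtain ⟨ι', _, hι'⟩ := ih (α → C)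
    obtain ⟨ι₀, _, hι₀⟩ := Combinatorics.Subspace.exists_mono_in_high_dimension (Option α) C ι'
    refine ⟨Option ι₀, inferInstance, fun c => ?_⟩
    obtain ⟨W, c₀, hW⟩ := hι₀ fun w => c fun i => i.elim none w
    let T₁ : Option ι₀ → α ⊕ (Unit ⊕ ι') := fun i => i.elim (Sum.inr (Sum.inl ()))
      fun i => Sum.elim (fun o => o.elim (Sum.inr (Sum.inl ())) Sum.inl)
        (fun e => Sum.inr (Sum.inr e)) (W.idxFun i)
    let ev : Option α → (ι' → Option α) → Option ι₀ → Option α := fun x v i =>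
      Sum.elim some (Sum.elim (fun _ => x) v) (T₁ i)
    have hev : ∀ v, c (ev none v) = c₀ := by
      intro v
      rw [← hW v]
      congr 1
      funext i
      rcases i with _ | i
      · rfl
      · rcases h : W.idxFun i with (_ | a) | e <;>
          simp [ev, T₁, h, Combinatorics.Subspace.apply_def]
    obtain ⟨T₂, hT₂⟩ := hι' fun v a => c (ev (some a) v)
    refine ⟨⟨fun i => Sum.elim Sum.inl (Sum.elim (fun _ => Sum.inr (Sum.inl 0)) fun e =>
      Sum.elim Sum.inl (Sum.elim (fun j => Sum.inr (Sum.inl j.succ)) fun e => Sum.inr (Sum.inr e))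
        (T₂.idxFun e)) (T₁ i), ?_⟩, ?_⟩
    · have hT₁ : ∀ e, ∃ i, T₁ i = Sum.inr (Sum.inr e) := fun e => by
        obtain ⟨i, hi⟩ := W.proper e
        exact ⟨some i, by simp [T₁, hi]⟩
      rintro (j | e)
      · refine Fin.cases ⟨none, by simp [T₁]⟩ (fun j => ?_) j
        obtain ⟨e', he'⟩ := T₂.proper (Sum.inl j)
        obtain ⟨i, hi⟩ := hT₁ e'
        exact ⟨i, by simp [hi, he']⟩
      · obtain ⟨e', he'⟩ := T₂.proper (Sum.inr e)
        obtain ⟨i, hi⟩ := hT₁ e'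
        exact ⟨i, by simp [hi, he']⟩
    · generalize hT : (⟨_, _⟩ : Subspace (Fin (m + 1) ⊕ κ) α (Option ι₀)) = T
      have key : ∀ z v, Subspace.bump T (Sum.elim z v) =
          ev (z 0) (Subspace.bump T₂ (Sum.elim (fun j => z j.succ) v)) := by
        intro z v
        funext i
        rw [← hT]
        rcases h : T₁ i with a | u | e
        · simp [ev, h, Subspace.bump, Combinatorics.Subspace.apply_def]
        · simp [ev, h, Subspace.bump, Combinatorics.Subspace.apply_def]
        · rcases h' : T₂.idxFun e with a | j | e' <;>
          simp [ev, h, h', Subspace.bump, Combinatorics.Subspace.apply_def]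
      rintro z ⟨j, hj⟩ v v'
      rw [key, key]
      rcases h0 : z 0 with _ | a
      · rw [hev, hev]
      · have : ∃ j : Fin m, z j.succ = none := by
          revert hj
          refine Fin.cases (fun h => ?_) (fun j hj => ⟨j, hj⟩) j
          rw [h0] at h; cases h
        exact congrFun (hT₂ (fun j => z j.succ) this v v') a

/-- Replace the letter `none` by `a`. -/
def col {α ι : Type*} (a : α) (x : ι → Option α) : ι → Option α := fun i => some ((x i).getD a)

lemma col_col {α ι : Type*} (a : α) (x : ι → Option α) : col a (col a x) = col a x := rfl

/-- Membership in `E` is unaffected by exchanging the letters `none` and `a`. -/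
def Insens {α ι : Type*} (a : α) (E : Set (ι → Option α)) : Prop := ∀ x, x ∈ E ↔ col a x ∈ E

lemma Insens.congr {α ι : Type*} {a : α} {E : Set (ι → Option α)} (h : Insens a E)
    {x y : ι → Option α} (hxy : col a x = col a y) : x ∈ E ↔ y ∈ E := by
  rw [h x, h y, hxy]

lemma Insens.compl {α ι : Type*} {a : α} {E : Set (ι → Option α)} (h : Insens a E) :
    Insens a Eᶜ := fun x => not_congr (h x)

lemma Insens.preimage {α ι η : Type*} {a : α} {E : Set (ι → Option α)} (h : Insens a E)
    (T : Subspace η (Option α) ι) : Insens a {z | T z ∈ E} := fun z => h.congr <| by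
  funext i
  rcases hi : T.idxFun i with o | e <;> simp [Combinatorics.Subspace.apply_def, col, hi]

/-- A typical word over `Option α` has many letters different from `none`. -/
lemma exists_support_small {α : Type} [Fintype α] [Nonempty α] (m : ℕ) {γ : ℝ} (hγ : 0 < γ) :
    ∃ n : ℕ, ∀ (ι : Type) [Fintype ι] [DecidableEq ι], n ≤ Fintype.card ι →
      den {x : ι → Option α | Fintype.card {i // x i ≠ none} < m} < γ := by
  set k : ℝ := (Fintype.card α : ℝ)
  have hk : 0 < k := by
    exact Nat.cast_pos.2 (Fintype.card_pos (α := α))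
  set q : ℝ := (1 + k / 2) / (1 + k)
  have hq0 : 0 ≤ q := by positivity
  have hq1 : q < 1 := by rw [div_lt_one (by positivity)]; linarith
  obtain ⟨n, hn⟩ := exists_pow_lt_of_lt_one (show 0 < γ / 2 ^ m by positivity) hq1
  refine ⟨n, fun ι _ _ hι => ?_⟩
  let g : Option α → ℝ := fun o => if o = none then 1 else 1 / 2
  have hg : ∑ o, g o = 1 + k / 2 := by
    rw [Fintype.sum_option]
    simp [g, k]
    ring
  have hE : 𝔼 x : ι → Option α, ∏ i, g (x i) = q ^ Fintype.card ι := by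
    rw [Fintype.expect_eq_sum_div_card]
    have := Finset.prod_univ_sum (fun _ : ι => (univ : Finset (Option α))) (fun _ o => g o)
    rw [Fintype.piFinset_univ] at this
    rw [← this, prod_const, hg, card_univ, Fintype.card_fun, Fintype.card_option]
    push_cast
    rw [← div_pow, add_comm (Fintype.card α : ℝ) 1]
  have hle : den {x : ι → Option α | Fintype.card {i // x i ≠ none} < m} ≤
      2 ^ m * q ^ Fintype.card ι := by
    rw [← hE, mul_expect]
    refine expect_le_expect fun x _ => ?_
    have hprod : ∏ i, g (x i) = (1 / 2) ^ Fintype.card {i // x i ≠ none} := by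
      simp only [g]
      rw [prod_ite, prod_const_one, one_mul, prod_const, Fintype.card_subtype]
    change ind (Fintype.card {i // x i ≠ none} < m) ≤ _
    by_cases hx : Fintype.card {i // x i ≠ none} < m
    · rw [ind_true hx, hprod, one_div, inv_pow]
      rw [← div_eq_mul_inv, one_le_div (by positivity)]
      exact pow_le_pow_right₀ (by norm_num) hx.le
    · rw [ind_false hx, hprod]
      positivity
  refine hle.trans_lt ?_
  have : q ^ Fintype.card ι < γ / 2 ^ m := (pow_le_pow_of_le_one hq0 hq1.le hι).trans_lt hn
  rw [lt_div_iff₀ (by positivity)] at this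
  linarith

/-- The average over all words, organised by the set of positions of `none`. -/
lemma expect_eq_expect_support {α ι : Type} [Fintype α] [Nonempty α] [Fintype ι] [DecidableEq ι]
    (F : (ι → Option α) → ℝ) :
    𝔼 x, F x = 𝔼 x : ι → Option α, 𝔼 u : {i // x i ≠ none} → α,
      F fun i => if h : x i ≠ none then some (u ⟨i, h⟩) else none := by
  let _ : AddCommGroup (Fin (Fintype.card α)) := by
    haveI : NeZero (Fintype.card α) := ⟨Fintype.card_ne_zero⟩
    infer_instance
  let _ : AddCommGroup α := (Fintype.equivFin α).addCommGroup
  have h1 : ∀ u : ι → α, 𝔼 x, F x = 𝔼 x : ι → Option α, F fun i => (x i).map (u i + ·) := by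
    intro u
    refine Fintype.expect_equiv
      (Equiv.piCongrRight fun i => (Equiv.addLeft (-u i)).optionCongr) _ _ fun x => ?_
    congr 1
    funext i
    rcases hi : x i with _ | a <;> simp [hi]
  have h2 : 𝔼 x, F x = 𝔼 u : ι → α, 𝔼 x : ι → Option α, F fun i => (x i).map (u i + ·) := by
    rw [expect_congr rfl fun u _ => (h1 u).symm, Fintype.expect_const]
  rw [h2, expect_comm]
  refine expect_congr rfl fun x _ => ?_
  rw [expect_join (Equiv.sumCompl fun i => x i ≠ none)]
  have h3 : ∀ u : {i // x i ≠ none} → α, ∀ v : {i // ¬ x i ≠ none} → α,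
      (fun i => (x i).map (join (Equiv.sumCompl fun i => x i ≠ none) u v i + ·)) =
        fun i => if h : x i ≠ none then some (u ⟨i, h⟩ + (x i).get (Option.isSome_iff_ne_none.2 h))
          else none := by
    intro u v
    funext i
    by_cases h : x i ≠ none
    · have hx := Option.some_get (Option.isSome_iff_ne_none.2 h)
      rw [dif_pos h]
      conv_lhs => rw [← hx]
      simp [join, Equiv.sumCompl_symm_apply_of_pos, h]
    · rw [dif_neg h]
      simp [not_not.1 h]
  simp only [h3, Fintype.expect_const]
  refine Fintype.expect_equiv (Equiv.addRight fun j : {i // x i ≠ none} =>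
    (x j).get (Option.isSome_iff_ne_none.2 j.2)) _ _ fun u => ?_
  congr 1

/-- Dense insensitive sets contain subspaces. -/
lemma exists_subspace_insens {α : Type} [Fintype α] [Nonempty α]
    (hα : ∀ δ : ℝ, 0 < δ → DHJAt α δ) (r : ℕ) {γ : ℝ} (hγ : 0 < γ) :
    ∃ n : ℕ, ∀ (ι : Type) [Fintype ι] [DecidableEq ι], n ≤ Fintype.card ι →
      ∀ (a : α) (E : Set (ι → Option α)), Insens a E → γ ≤ den E →
        ∃ T : Subspace (Fin r) (Option α) ι, ∀ z, T z ∈ E := by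
  obtain ⟨m, hm⟩ := exists_subspace hα r (γ / 2) (by linarith)
  obtain ⟨n, hn⟩ := exists_support_small (α := α) m (half_pos hγ)
  refine ⟨n, fun ι _ _ hι a E hE hden => ?_⟩
  have h0 := hden
  unfold den at h0
  rw [expect_eq_expect_support] at h0
  set w : (x : ι → Option α) → ({i // x i ≠ none} → α) → ι → Option α :=
    fun x u i => if h : x i ≠ none then some (u ⟨i, h⟩) else none with hw
  have h1 := h0.trans (expect_le_den_add (F := fun x => den {u | w x u ∈ E})
    (fun x => den_le_one _) (c := γ / 2) (by linarith))
  have h2 : ∃ x, γ / 2 ≤ den {u | w x u ∈ E} ∧ m ≤ Fintype.card {i // x i ≠ none} := by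
    by_contra! hcon
    have := (den_mono (A := {x | γ / 2 ≤ den {u | w x u ∈ E}}) fun x hx => hcon x hx).trans_lt
      (hn ι hι)
    linarith
  obtain ⟨x, hx1, hx2⟩ := h2
  obtain ⟨T, hT⟩ := hm _ hx2 _ hx1
  refine ⟨⟨fun i => if h : x i ≠ none then (T.idxFun ⟨i, h⟩).map some id else Sum.inl none,
    fun e => ?_⟩, fun z => ?_⟩
  · obtain ⟨i, hi⟩ := T.proper e
    exact ⟨i, by simp [i.2, hi]⟩
  · refine (hE.congr ?_).1 (hT fun e => (z e).getD a)
    funext i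
    by_cases h : x i ≠ none
    · rcases hi : T.idxFun ⟨i, h⟩ with b | e <;>
        simp [hw, col, Combinatorics.Subspace.apply_def, h, hi]
    · simp [hw, col, Combinatorics.Subspace.apply_def, not_not.1 h]

lemma Subspace.injective {η α ι : Type*} (T : Subspace η α ι) :
    Function.Injective fun z : η → α => T z := by
  intro z z' h
  funext e
  obtain ⟨i, hi⟩ := T.proper e
  have := congrFun h i
  simpa [Combinatorics.Subspace.apply_def, hi] using this

/-- A subspace of a subspace. -/
def Subspace.comp {η η' α ι : Type*} (T : Subspace η α ι) (T' : Subspace η' α η) :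
    Subspace η' α ι where
  idxFun i := Sum.elim Sum.inl T'.idxFun (T.idxFun i)
  proper e := by
    obtain ⟨j, hj⟩ := T'.proper e
    obtain ⟨i, hi⟩ := T.proper j
    exact ⟨i, by simp [hi, hj]⟩

lemma Subspace.comp_apply {η η' α ι : Type*} (T : Subspace η α ι) (T' : Subspace η' α η)
    (z : η' → α) : Subspace.comp T T' z = T (T' z) := by
  funext i
  rcases hi : T.idxFun i with o | e <;>
    simp [Combinatorics.Subspace.apply_def, Subspace.comp, hi]

/-- The average of `F` over every `r`-dimensional subspace is at most `σ`. -/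
def SubBound {α ι : Type*} [Fintype α] (r : ℕ) (F : (ι → α) → ℝ) (σ : ℝ) : Prop :=
  ∀ T : Subspace (Fin r) α ι, 𝔼 z, F (T z) ≤ σ

lemma col_join {α ι κ μ : Type*} (e : κ ⊕ μ ≃ ι) (a : α) (u : κ → Option α) (v : μ → Option α) :
    col a (join e u v) = join e (col a u) (col a v) := by
  funext i
  rcases h : e.symm i with j | j <;> simp [col, join, h]

lemma expect_ind_range {X Y : Type*} [Fintype X] [Fintype Y] [Nonempty Y] {T : Y → X}
    (hT : Function.Injective T) {G : X → ℝ} {σ : ℝ} (h : 𝔼 z, G (T z) ≤ σ) :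
    𝔼 u, (G u - σ) * ind (u ∈ Set.range T) ≤ 0 := by
  have h1 : ∑ z, (G (T z) - σ) = ∑ u, (G u - σ) * ind (u ∈ Set.range T) :=
    Fintype.sum_of_injective T hT _ _ (fun u hu => by rw [ind_false hu, mul_zero])
      fun z => by rw [ind_true ⟨z, rfl⟩, mul_one]
  have h2 : 𝔼 z, (G (T z) - σ) ≤ 0 := by
    rw [expect_sub_distrib, Fintype.expect_const]; linarith
  rw [Fintype.expect_eq_sum_div_card] at h2 ⊢
  rw [← h1]
  have hc : (0 : ℝ) < Fintype.card Y := Nat.cast_pos.2 Fintype.card_pos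
  have h3 : ∑ z, (G (T z) - σ) ≤ 0 := by
    by_contra! hcon
    exact absurd h2 (not_le.2 (div_pos hcon hc))
  exact div_nonpos_of_nonpos_of_nonneg h3 (Nat.cast_nonneg _)

lemma one_div_card_le_den {X : Type*} [Fintype X] {V : Set X} (hV : V.Nonempty) :
    1 / (Fintype.card X : ℝ) ≤ den V := by
  obtain ⟨x, hx⟩ := hV
  unfold den
  rw [Fintype.expect_eq_sum_div_card]
  gcongr
  rw [← ind_true hx]
  exact single_le_sum (f := fun x => ind (x ∈ V)) (fun _ _ => ind_nonneg _) (mem_univ x)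

lemma expect_insens_step {α : Type} [Fintype α] {r n : ℕ} {γ : ℝ} (hγ : 0 ≤ γ)
    (hn : ∀ (a : α) (E : Set (Fin n → Option α)), Insens a E → γ / 2 ≤ den E →
      ∃ T : Subspace (Fin r) (Option α) (Fin n), ∀ z, T z ∈ E) (s : ℕ) :
    ∀ (ι : Type) [Fintype ι] [DecidableEq ι], s * n ≤ Fintype.card ι →
      ∀ (F : (ι → Option α) → ℝ) (σ : ℝ), (∀ x, F x ≤ 1) → 0 ≤ σ → SubBound r F σ →
      ∀ (a : α) (D : Set (ι → Option α)), Insens a D →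
        𝔼 x, (F x - σ) * ind (x ∈ D) ≤
          γ / 2 + (1 - 1 / (Fintype.card (Fin n → Option α) : ℝ)) ^ s * (den D - γ / 2) := by
  have hc : 1 ≤ (Fintype.card (Fin n → Option α) : ℝ) := by
    exact_mod_cast Fintype.card_pos (α := Fin n → Option α)
  set ρ : ℝ := 1 / (Fintype.card (Fin n → Option α) : ℝ) with hρ
  have hρ0 : 0 ≤ ρ := by positivity
  have hρ1 : ρ ≤ 1 := by rw [hρ, div_le_one (by linarith)]; exact hc
  induction s with
  | zero =>
    intro ι _ _ _ F σ hF hσ _ a D _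
    rw [pow_zero, one_mul, add_sub_cancel]
    refine expect_le_expect fun x _ => ?_
    have := hF x
    nlinarith [ind_nonneg (x ∈ D)]
  | succ s ih =>
    intro ι _ _ hι F σ hF hσ hsub a D hD
    have hι' : n + s * n ≤ Fintype.card ι := by rw [add_mul] at hι; omega
    obtain ⟨e⟩ := exists_split (a := n) (ι := ι) (by omega)
    have hV : ∀ E : Set (Fin n → Option α), ∃ V : Set (Fin n → Option α),
        (γ / 2 ≤ den E → Insens a E → V ⊆ E ∧ V.Nonempty) ∧ (¬ (γ / 2 ≤ den E ∧ Insens a E) → V = ∅) ∧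
        ∀ G : (Fin n → Option α) → ℝ, SubBound r G σ → 𝔼 u, (G u - σ) * ind (u ∈ V) ≤ 0 := by
      intro E
      by_cases hE : γ / 2 ≤ den E ∧ Insens a E
      · obtain ⟨T, hT⟩ := hn a E hE.2 hE.1
        refine ⟨Set.range fun z => T z, fun _ _ => ⟨?_, Set.range_nonempty _⟩,
          fun h => absurd hE h, fun G hG => expect_ind_range (Subspace.injective T) (hG T)⟩
        rintro _ ⟨z, rfl⟩
        exact hT z
      · exact ⟨∅, fun h h' => absurd ⟨h, h'⟩ hE, fun _ => rfl, fun G _ => by simp [ind]⟩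
    choose V hV1 hV2 hV3 using hV
    let S : (Fin (Fintype.card ι - n) → Option α) → Set (Fin n → Option α) :=
      fun y => {u | join e u y ∈ D}
    have hS : ∀ y, Insens a (S y) := fun y u => hD.congr <| by
      rw [col_join, col_join, col_col]
    have hS' : ∀ y, S y = S (col a y) := fun y => by
      ext u
      exact hD.congr (by rw [col_join, col_join, col_col])
    have hVS : ∀ y, V (S y) ⊆ S y := fun y => by
      by_cases h : γ / 2 ≤ den (S y)
      · exact (hV1 _ h (hS y)).1
      · rw [hV2 _ fun h' => h h'.1]; exact Set.empty_subset _
    let D' : (Fin n → Option α) → Set (Fin (Fintype.card ι - n) → Option α) :=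
      fun u => {y | u ∈ S y ∧ u ∉ V (S y)}
    have hD' : ∀ u, Insens a (D' u) := fun u y => by
      change (u ∈ S y ∧ u ∉ V (S y)) ↔ (u ∈ S (col a y) ∧ u ∉ V (S (col a y)))
      rw [← hS' y]
    have hsplit : ∀ u y, ind (join e u y ∈ D) = ind (y ∈ D' u) + ind (u ∈ V (S y)) := by
      intro u y
      change ind (u ∈ S y) = _
      by_cases h : u ∈ V (S y)
      · rw [ind_true h, ind_true (hVS y h), ind_false (show y ∉ D' u from fun h' => h'.2 h)]
        norm_num
      · rw [ind_false h, add_zero]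
        by_cases h' : u ∈ S y
        · rw [ind_true h', ind_true (show y ∈ D' u from ⟨h', h⟩)]
        · rw [ind_false h', ind_false (show y ∉ D' u from fun h => h' h.1)]
    have hfirst : 𝔼 x, (F x - σ) * ind (x ∈ D) ≤
        𝔼 u, 𝔼 y, (F (join e u y) - σ) * ind (y ∈ D' u) := by
      rw [expect_join' e, expect_comm (s := univ (α := Fin n → Option α))]
      refine expect_le_expect fun y _ => ?_
      have := hV3 (S y) (fun u => F (join e u y)) fun T => by
        have := hsub (Subspace.constRight e T y)
        simpa only [Subspace.constRight_apply] using this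
      simp only [hsplit, mul_add, expect_add_distrib]
      linarith
    have hsecond : ∀ u, 𝔼 y, (F (join e u y) - σ) * ind (y ∈ D' u) ≤
        γ / 2 + (1 - ρ) ^ s * (den (D' u) - γ / 2) := fun u =>
      ih _ (by simp; omega) (fun y => F (join e u y)) σ (fun y => hF _) hσ (fun T => by
        have := hsub (Subspace.constLeft e u T)
        simpa only [Subspace.constLeft_apply] using this) a (D' u) (hD' u)
    have hthird : 𝔼 u, den (D' u) - γ / 2 ≤ (1 - ρ) * (den D - γ / 2) := by
      have e1 : 𝔼 u, den (D' u) = 𝔼 y, (den (S y) - den (V (S y))) := by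
        unfold den
        rw [expect_comm]
        refine expect_congr rfl fun y _ => ?_
        rw [← expect_sub_distrib]
        refine expect_congr rfl fun u _ => ?_
        have := hsplit u y
        change ind (u ∈ S y) = _ at this
        rw [this]; ring
      have e2 : den D = 𝔼 y, den (S y) := by
        unfold den
        rw [expect_join' e]
        rfl
      have e3 : 𝔼 y, (den (S y) - den (V (S y))) ≤
          𝔼 y, (γ / 2 + (1 - ρ) * (den (S y) - γ / 2)) := by
        refine expect_le_expect fun y _ => ?_
        by_cases h : γ / 2 ≤ den (S y)
        · have h1 := one_div_card_le_den (hV1 _ h (hS y)).2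
          rw [← hρ] at h1
          nlinarith [den_le_one (S y)]
        · nlinarith [den_nonneg (V (S y)), not_le.1 h]
      rw [← e1, expect_add_distrib, Fintype.expect_const, ← mul_expect, expect_sub_distrib,
        Fintype.expect_const, ← e2] at e3
      linarith
    calc _ ≤ _ := hfirst
      _ ≤ 𝔼 u, (γ / 2 + (1 - ρ) ^ s * (den (D' u) - γ / 2)) :=
        expect_le_expect fun u _ => hsecond u
      _ = γ / 2 + (1 - ρ) ^ s * (𝔼 u, den (D' u) - γ / 2) := by
        rw [expect_add_distrib, Fintype.expect_const, ← mul_expect, expect_sub_distrib,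
          Fintype.expect_const]
      _ ≤ γ / 2 + (1 - ρ) ^ s * ((1 - ρ) * (den D - γ / 2)) := by
        have : 0 ≤ (1 - ρ) ^ s := pow_nonneg (by linarith) _
        gcongr
      _ = _ := by rw [pow_succ]; ring

lemma expect_insens {α : Type} [Fintype α] [Nonempty α] (hα : ∀ δ : ℝ, 0 < δ → DHJAt α δ) (r : ℕ)
    {γ : ℝ} (hγ : 0 < γ) : ∃ n : ℕ, ∀ (ι : Type) [Fintype ι] [DecidableEq ι],
      n ≤ Fintype.card ι → ∀ (F : (ι → Option α) → ℝ) (σ : ℝ), (∀ x, F x ≤ 1) → 0 ≤ σ →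
      SubBound r F σ → ∀ (a : α) (D : Set (ι → Option α)), Insens a D →
        𝔼 x, (F x - σ) * ind (x ∈ D) ≤ γ := by
  obtain ⟨n, hn⟩ := exists_subspace_insens hα r (half_pos hγ)
  have hc : 1 ≤ (Fintype.card (Fin n → Option α) : ℝ) := by
    exact_mod_cast Fintype.card_pos (α := Fin n → Option α)
  set ρ : ℝ := 1 / (Fintype.card (Fin n → Option α) : ℝ) with hρ
  have hρ0 : 0 < ρ := by positivity
  have hρ1 : ρ ≤ 1 := by rw [hρ, div_le_one (by linarith)]; exact hc
  obtain ⟨s, hs⟩ := exists_pow_lt_of_lt_one (half_pos hγ) (show 1 - ρ < 1 by linarith)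
  refine ⟨s * n, fun ι _ _ hι F σ hF hσ hsub a D hD => ?_⟩
  have := expect_insens_step hγ.le (fun a E => hn (Fin n) (by simp) a E) s ι hι F σ hF hσ hsub a D hD
  have h0 : 0 ≤ (1 - ρ) ^ s := pow_nonneg (by linarith) _
  nlinarith [den_le_one D]

/-- Correlation with intersections of insensitive sets is controlled by averages over subspaces. -/
lemma expect_inter_insens {α : Type} [Fintype α] [Nonempty α]
    (hα : ∀ δ : ℝ, 0 < δ → DHJAt α δ) (S : Finset α) : ∀ (r : ℕ) (γ : ℝ), 0 < γ →
    ∃ n : ℕ, ∀ (ι : Type) [Fintype ι] [DecidableEq ι],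
      n ≤ Fintype.card ι → ∀ (F : (ι → Option α) → ℝ) (σ : ℝ), (∀ x, F x ≤ 1) → 0 ≤ σ →
      SubBound r F σ → ∀ D : α → Set (ι → Option α), (∀ a, Insens a (D a)) →
        𝔼 x, F x * ind (∀ a ∈ S, x ∈ D a) ≤ σ + γ := by
  induction S using Finset.induction_on with
  | empty =>
    intro r γ hγ
    refine ⟨r, fun ι _ _ hι F σ _ _ hsub D _ => ?_⟩
    obtain ⟨e⟩ := exists_split hι
    have h1 : ∀ x, F x * ind (∀ a ∈ (∅ : Finset α), x ∈ D a) = F x := fun x => by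
      rw [ind_true (by simp), mul_one]
    simp only [h1]
    rw [expect_join' e]
    refine (expect_le univ_nonempty (a := σ) fun v _ => ?_).trans (by linarith)
    let T : Subspace (Fin r) (Option α) (Fin r) := ⟨fun i => Sum.inr i, fun e => ⟨e, rfl⟩⟩
    have h2 : ∀ z, T z = z := fun z => rfl
    have := hsub (Subspace.constRight e T v)
    simpa only [Subspace.constRight_apply, h2] using this
  | insert b S _ ih =>
    intro r γ hγ
    obtain ⟨r', hr'⟩ := ih r (γ / 2) (half_pos hγ)
    obtain ⟨n, hn⟩ := expect_insens hα r' (half_pos hγ)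
    refine ⟨n, fun ι _ _ hι F σ hF hσ hsub D hD => ?_⟩
    have h1 := hn ι hι (fun x => F x * ind (∀ a ∈ S, x ∈ D a)) (σ + γ / 2) (fun x => by
        by_cases h : ∀ a ∈ S, x ∈ D a
        · rw [ind_true h, mul_one]; exact hF x
        · rw [ind_false h, mul_zero]; norm_num) (by linarith) (fun T => by
        refine hr' (Fin r') (by simp) (fun z => F (T z)) σ (fun z => hF _) hσ (fun T' => ?_)
          (fun a => {z | T z ∈ D a}) (fun a => (hD a).preimage T)
        have := hsub (Subspace.comp T T')
        simpa only [Subspace.comp_apply] using this) b (D b) (hD b)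
    have h2 : ∀ x, F x * ind (∀ a ∈ insert b S, x ∈ D a) =
        (F x * ind (∀ a ∈ S, x ∈ D a) - (σ + γ / 2)) * ind (x ∈ D b) +
          (σ + γ / 2) * ind (x ∈ D b) := by
      intro x
      have : ind (∀ a ∈ insert b S, x ∈ D a) = ind (∀ a ∈ S, x ∈ D a) * ind (x ∈ D b) := by
        by_cases hb : x ∈ D b <;> by_cases hS : ∀ a ∈ S, x ∈ D a <;>
          simp only [ind, forall_mem_insert, hb, hS, true_and, and_false, false_and,
            if_true, if_false] <;> norm_num
      rw [this]; ring
    simp only [h2, expect_add_distrib, ← mul_expect]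
    have h3 := den_le_one (D b)
    unfold den at h3
    nlinarith

lemma HasLine.of_subspace {α η ι : Type*} (T : Subspace η α ι) {A : Set (ι → α)}
    (h : HasLine {z | T z ∈ A}) : HasLine A := by
  obtain ⟨l, hl⟩ := h
  obtain ⟨e, he⟩ := l.proper
  obtain ⟨i, hi⟩ := T.proper e
  refine ⟨⟨fun i => Sum.elim some l.idxFun (T.idxFun i), i, by simp [hi, he]⟩, fun a => ?_⟩
  have := hl a
  change T (l a) ∈ A at this
  convert this using 1
  funext i
  rcases h : T.idxFun i with b | e <;> simp [Combinatorics.Subspace.apply_def, h]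

/-- The subspace of all words. -/
def Subspace.full (α ι : Type*) : Subspace ι α ι := ⟨fun i => Sum.inr i, fun e => ⟨e, rfl⟩⟩

lemma Subspace.full_apply {α ι : Type*} (z : ι → α) : Subspace.full α ι z = z := rfl

/-- The subspace obtained by fixing the first block of wildcards. -/
def Subspace.fixLeft {η η' α ι : Type*} (T : Subspace (η ⊕ η') α ι) (z : η → α) :
    Subspace η' α ι where
  idxFun i := Sum.elim Sum.inl (Sum.elim (fun j => Sum.inl (z j)) Sum.inr) (T.idxFun i)
  proper e := by
    obtain ⟨i, hi⟩ := T.proper (Sum.inr e)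
    exact ⟨i, by simp [hi]⟩

lemma Subspace.fixLeft_apply {η η' α ι : Type*} (T : Subspace (η ⊕ η') α ι) (z : η → α)
    (v : η' → α) : Subspace.fixLeft T z v = T (Sum.elim z v) := by
  funext i
  rcases h : T.idxFun i with b | j | e <;>
    simp [Combinatorics.Subspace.apply_def, Subspace.fixLeft, h]

lemma expect_union_insens {α ι : Type} [Fintype α] [Fintype ι] [DecidableEq ι]
    {F : (ι → Option α) → ℝ} {γ : ℝ}
    (hF : ∀ D : α → Set (ι → Option α), (∀ a, Insens a (D a)) →
      𝔼 x, F x * ind (∀ a ∈ univ, x ∈ D a) ≤ γ)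
    {D : α → Set (ι → Option α)} (hD : ∀ a, Insens a (D a)) (S : Finset α) :
    𝔼 x, F x * ind (∃ a ∈ S, x ∉ D a) ≤ #S * γ := by
  induction S using Finset.induction_on with
  | empty => simp [ind]
  | insert b S hb ih =>
    let D' : α → Set (ι → Option α) := fun a =>
      if a = b then (D b)ᶜ else if a ∈ S then D a else Set.univ
    have h1 := hF D' fun a => by
      by_cases h : a = b
      · simp only [D', h, if_true]; exact (hD b).compl
      · by_cases h' : a ∈ S
        · simp only [D', h, h', if_true, if_false]; exact hD a
        · simp only [D', h, h', if_false]; exact fun x => Iff.rfl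
    have h2 : ∀ x, (∀ a ∈ univ, x ∈ D' a) ↔ (x ∉ D b ∧ ∀ a ∈ S, x ∈ D a) := by
      intro x
      constructor
      · refine fun h => ⟨by simpa [D'] using h b (mem_univ _), fun a ha => ?_⟩
        have hab : a ≠ b := fun hab => hb (hab ▸ ha)
        simpa [D', hab, ha] using h a (mem_univ _)
      · rintro ⟨h, h'⟩ a -
        by_cases hab : a = b
        · simpa [D', hab] using h
        · by_cases ha : a ∈ S
          · simpa [D', hab, ha] using h' a ha
          · simp [D', hab, ha]
    have h3 : ∀ x, ind (∃ a ∈ insert b S, x ∉ D a) =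
        ind (∃ a ∈ S, x ∉ D a) + ind (∀ a ∈ univ, x ∈ D' a) := by
      intro x
      rw [h2, exists_mem_insert]
      by_cases h : ∃ a ∈ S, x ∉ D a
      · rw [ind_true (Or.inr h), ind_true h, ind_false fun h' => by
          obtain ⟨a, ha, hx⟩ := h
          exact hx (h'.2 a ha)]
        norm_num
      · rw [ind_false h, zero_add]
        push Not at h
        by_cases h' : x ∈ D b
        · rw [ind_false (p := x ∉ D b ∧ ∀ a ∈ S, x ∈ D a) fun h'' => h''.1 h', ind_false]
          rintro (h'' | ⟨a, ha, hx⟩)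
          · exact h'' h'
          · exact hx (h a ha)
        · rw [ind_true (Or.inl h'), ind_true ⟨h', h⟩]
    simp only [h3, mul_add, expect_add_distrib]
    rw [card_insert_of_notMem hb]
    push_cast
    linarith

/-- In a minimal counterexample to the density Hales-Jewett theorem all slices have nearly the same
density. -/
lemma exists_uniform_lineFree {β ι : Type} [Fintype β] [Nonempty β] [Fintype ι] [DecidableEq ι]
    {δ : ℝ}
    (h1 : ∀ ε : ℝ, 0 < ε → DHJAt β (δ + ε)) (h2 : ∀ ε : ℝ, 0 < ε → ε < δ → ¬ DHJAt β (δ - ε))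
    {τ : ℝ} (hτ : 0 < τ) (hτδ : τ < δ) :
    ∃ (n : ℕ) (ι₁ : Type) (e : ι ⊕ Fin n ≃ ι₁) (A : Set (ι₁ → β)), ¬ HasLine A ∧
      ∀ x, δ - τ ≤ den {y | join e x y ∈ A} := by
  have hR : 1 ≤ (Fintype.card (ι → β) : ℝ) := by
    exact_mod_cast Fintype.card_pos (α := ι → β)
  set R : ℝ := (Fintype.card (ι → β) : ℝ) with hRdef
  have hε : 0 < τ / (2 * R) := by positivity
  set ε := τ / (2 * R) with hεdef
  have hεR : 2 * R * ε = τ := by rw [hεdef]; field_simp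
  obtain ⟨n, hn⟩ := h1 ε hε
  have h3 := h2 ε hε (by nlinarith)
  unfold DHJAt at h3
  push Not at h3
  obtain ⟨ι₁, _, _, hι₁, A, hA, hAl⟩ := h3 (Fintype.card ι + n)
  have e : ι ⊕ Fin (Fintype.card ι₁ - Fintype.card ι) ≃ ι₁ :=
    Fintype.equivOfCardEq (by simp; omega)
  refine ⟨_, ι₁, e, A, hAl, fun x₀ => ?_⟩
  have h4 : ∀ x, den {y | join e x y ∈ A} ≤ δ + ε := by
    intro x
    by_contra! hcon
    refine hAl (HasLine.of_subspace (Subspace.constLeft e x (Subspace.full β _)) ?_)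
    refine hn _ (by simp; omega) _ (hcon.le.trans_eq ?_)
    congr 1
    ext y
    change _ ↔ Subspace.constLeft e x (Subspace.full β _) y ∈ A
    rw [Subspace.constLeft_apply, Subspace.full_apply]
    rfl
  have h5 : 𝔼 x, (δ + ε - den {y | join e x y ∈ A}) ≤ 2 * ε := by
    have : den A = 𝔼 x, den {y | join e x y ∈ A} := expect_join e _
    rw [expect_sub_distrib, Fintype.expect_const, ← this]
    linarith
  rw [Fintype.expect_eq_sum_div_card, ← hRdef, div_le_iff₀ (by linarith)] at h5
  have h6 := single_le_sum (f := fun x => δ + ε - den {y | join e x y ∈ A})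
    (fun x _ => sub_nonneg.2 (h4 x)) (mem_univ x₀)
  linarith

lemma not_critical_density {α : Type} [Fintype α] [Nonempty α]
    (hα : ∀ δ : ℝ, 0 < δ → DHJAt α δ) {δ : ℝ} (hδ : 0 < δ)
    (h1 : ∀ ε : ℝ, 0 < ε → DHJAt (Option α) (δ + ε))
    (h2 : ∀ ε : ℝ, 0 < ε → ε < δ → ¬ DHJAt (Option α) (δ - ε)) : False := by
  obtain ⟨m, hm⟩ := hα (δ / 2 / 2) (by linarith)
  have hcm : (0 : ℝ) < Fintype.card (Fin m → Option α) := Nat.cast_pos.2 Fintype.card_pos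
  set θ : ℝ := δ / 2 / 2 / Fintype.card (Fin m → Option α) with hθdef
  have hθ : 0 < θ := by positivity
  set k : ℝ := (Fintype.card α : ℝ) with hk
  have hk0 : 0 ≤ k := Nat.cast_nonneg _
  set η : ℝ := δ * θ / 8 with hη
  have hη0 : 0 < η := by positivity
  set γ : ℝ := δ * θ / (8 * (k + 1)) with hγ
  have hγ0 : 0 < γ := by positivity
  have hγk : (k + 1) * γ = δ * θ / 8 := by rw [hγ]; field_simp
  obtain ⟨r, hr⟩ := h1 γ hγ0
  obtain ⟨n₁, hn₁⟩ := expect_inter_insens hα univ r γ hγ0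
  have hε₂ : 0 < η * θ / 8 := by positivity
  obtain ⟨n₂, hn₂⟩ := h1 _ hε₂
  obtain ⟨ι, _, hι⟩ := exists_subspace_color (α := α) (κ := Fin (n₁ + n₂)) m Prop
  set τ : ℝ := min (min (η / 2) (η * θ / 8)) (δ / 2) with hτ
  have hτ0 : 0 < τ := by positivity
  have hτ1 : τ ≤ η / 2 := (min_le_left _ _).trans (min_le_left _ _)
  have hτ2 : τ ≤ η * θ / 8 := (min_le_left _ _).trans (min_le_right _ _)
  have hτ3 : τ ≤ δ / 2 := min_le_right _ _
  obtain ⟨n, ι₁, e, A, hAl, hA⟩ := exists_uniform_lineFree (ι := ι) h1 h2 hτ0 (by linarith)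
  obtain ⟨T, hT⟩ := hι fun x => θ ≤ den {y | ∀ a, join e (col a x) y ∈ A}
  obtain ⟨a₀⟩ := ‹Nonempty α›
  let v₀ : Fin (n₁ + n₂) → Option α := fun _ => some a₀
  obtain ⟨l, hl⟩ := exists_common_line (δ := δ / 2) (by linarith) (hm (Fin m) (by simp))
    (fun y => {z | join e (Subspace.bump T (Sum.elim (fun j => some (z j)) v₀)) y ∈ A}) (by
      unfold den
      rw [expect_comm]
      refine le_expect univ_nonempty fun z _ => ?_
      have := hA (Subspace.bump T (Sum.elim (fun j => some (z j)) v₀))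
      unfold den at this
      exact le_trans (by linarith) this)
  set z := l.idxFun with hz
  let W : (Fin (n₁ + n₂) → Option α) → ι → Option α := fun v => Subspace.bump T (Sum.elim z v)
  have hgood₀ : θ ≤ den {y | ∀ a, join e (col a (W v₀)) y ∈ A} := by
    refine hl.trans (den_mono fun y hy a => ?_)
    have := hy a
    change join e _ y ∈ A at this
    convert this using 2
    funext i
    rcases h : T.idxFun i with b | j | j
    · simp only [col, W, Subspace.bump_apply_inl T _ h, Option.getD_some]
    · simp only [col, W, Subspace.bump_apply_inr T _ h, Sum.elim_inl]; rfl
    · simp only [col, W, Subspace.bump_apply_inr T _ h, Sum.elim_inr, v₀, Option.getD_some]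
  have hgood : ∀ v, θ ≤ den {y | ∀ a, join e (col a (W v)) y ∈ A} := fun v =>
    (hT z l.proper v₀ v).mp hgood₀
  let A' : (Fin n → Option α) → Set (Fin (n₁ + n₂) → Option α) := fun y => {v | join e (W v) y ∈ A}
  let C : (Fin n → Option α) → α → Set (Fin (n₁ + n₂) → Option α) := fun y a =>
    {v | join e (col a (W v)) y ∈ A}
  have hC : ∀ y a, Insens a (C y a) := by
    intro y a v
    change join e (col a (W v)) y ∈ A ↔ join e (col a (W (col a v))) y ∈ A
    have : col a (W v) = col a (W (col a v)) := by
      funext i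
      rcases h : T.idxFun i with b | j | j
      · simp only [col, W, Subspace.bump_apply_inl T _ h]
      · simp only [col, W, Subspace.bump_apply_inr T _ h, Sum.elim_inl]
      · simp only [col, W, Subspace.bump_apply_inr T _ h, Sum.elim_inr, Option.getD_some]
    rw [this]
  have hA'l : ∀ y, ¬ HasLine (A' y) := by
    intro y hy
    refine hAl (HasLine.of_subspace
      (Subspace.constRight e (Subspace.fixLeft (Subspace.bump T) z) y) ?_)
    convert hy using 1
    ext v
    change Subspace.constRight e (Subspace.fixLeft (Subspace.bump T) z) y v ∈ A ↔
      join e (W v) y ∈ A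
    rw [Subspace.constRight_apply, Subspace.fixLeft_apply]
  have hdisj : ∀ y v, v ∈ A' y → ∃ a, v ∉ C y a := by
    intro y v hv
    by_contra! hcon
    obtain ⟨j, hj⟩ := l.proper
    obtain ⟨i, hi⟩ := T.proper (Sum.inl j)
    refine hAl ⟨⟨fun p => Sum.elim (fun i => (W v i).map some) (fun j => some (y j)) (e.symm p),
      e (Sum.inl i), ?_⟩, fun o => ?_⟩
    · simp [W, Subspace.bump_apply_inr T _ hi, hz, hj]
    · rcases o with _ | a
      · have : join e (W v) y ∈ A := hv
        convert this using 1
        funext p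
        rcases h : e.symm p with i | i
        · rcases h' : W v i <;> simp [join, h, h']
        · simp [join, h]
      · have : join e (col a (W v)) y ∈ A := hcon a
        convert this using 1
        funext p
        rcases h : e.symm p with i | i
        · rcases h' : W v i <;> simp [join, h, h', col]
        · simp [join, h]
  have hsum : δ - τ + η / 2 * θ ≤ 𝔼 y, (den (A' y) + η / 2 * den {v | ∀ a, v ∈ C y a}) := by
    rw [expect_add_distrib, ← mul_expect]
    have e1 : δ - τ ≤ 𝔼 y, den (A' y) := by
      unfold den
      rw [expect_comm]
      exact le_expect univ_nonempty fun v _ => hA (W v)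
    have e2 : θ ≤ 𝔼 y, den {v | ∀ a, v ∈ C y a} := by
      unfold den
      rw [expect_comm]
      exact le_expect univ_nonempty fun v _ => hgood v
    have : η / 2 * θ ≤ η / 2 * 𝔼 y, den {v | ∀ a, v ∈ C y a} := by gcongr
    linarith
  obtain ⟨y, -, hy⟩ := exists_le_of_le_expect univ_nonempty hsum
  have hA'up : den (A' y) < δ + η * θ / 8 := by
    by_contra! hcon
    exact hA'l y (hn₂ _ (by simp) _ hcon)
  have hC1 := den_le_one {v | ∀ a, v ∈ C y a}
  have hClow : θ / 2 ≤ den {v | ∀ a, v ∈ C y a} := by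
    by_contra! hcon
    have : η / 2 * den {v | ∀ a, v ∈ C y a} < η / 2 * (θ / 2) := by gcongr
    linarith
  have hA'low : δ - η ≤ den (A' y) := by
    have h0 : η / 2 * den {v | ∀ a, v ∈ C y a} ≤ η / 2 * 1 := by gcongr
    have h00 : 0 ≤ η / 2 * θ := by positivity
    linarith
  let F : (Fin (n₁ + n₂) → Option α) → ℝ := fun v => ind (v ∈ A' y) - (δ + γ)
  have hfin := expect_union_insens (F := F) (γ := γ) (fun D hD => by
    have := hn₁ (Fin (n₁ + n₂)) (by simp) F 0
      (fun v => by have := ind_le_one (v ∈ A' y); simp only [F]; linarith) le_rfl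
      (fun S => by
        simp only [F]
        rw [expect_sub_distrib, Fintype.expect_const, sub_nonpos]
        by_contra! hcon
        exact hA'l y (HasLine.of_subspace S (hr (Fin r) (by simp) _ hcon.le))) D hD
    rwa [zero_add] at this) (hC y) univ
  have hident : ∀ v, F v * ind (∃ a ∈ univ, v ∉ C y a) =
      ind (v ∈ A' y) - (δ + γ) * (1 - ind (v ∈ {v | ∀ a, v ∈ C y a})) := by
    intro v
    by_cases h : ∃ a ∈ univ, v ∉ C y a
    · rw [ind_true h, ind_false (show v ∉ {v | ∀ a, v ∈ C y a} from fun h' => by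
        obtain ⟨a, -, ha⟩ := h
        exact ha (h' a))]
      simp only [F]; ring
    · have h' : ∀ a, v ∈ C y a := by
        intro a
        by_contra ha
        exact h ⟨a, mem_univ _, ha⟩
      have hv : v ∉ A' y := fun hv => by
        obtain ⟨a, ha⟩ := hdisj y v hv
        exact ha (h' a)
      rw [ind_false h, ind_false hv, ind_true (show v ∈ {v | ∀ a, v ∈ C y a} from h')]
      ring
  simp only [hident] at hfin
  rw [expect_sub_distrib, ← mul_expect, expect_sub_distrib, Fintype.expect_const, card_univ] at hfin
  change den (A' y) - (δ + γ) * (1 - den {v | ∀ a, v ∈ C y a}) ≤ k * γ at hfin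
  have hg : 0 < (δ + γ) := by linarith
  have h7 : (δ + γ) * (θ / 2) ≤ (δ + γ) * den {v | ∀ a, v ∈ C y a} := by gcongr
  have h8 : 0 < γ * (θ / 2) := by positivity
  nlinarith [mul_pos hδ hθ]

lemma DHJAt.mono {α : Type} [Fintype α] {δ δ' : ℝ} (h : DHJAt α δ) (hδ : δ ≤ δ') : DHJAt α δ' := by
  obtain ⟨n, hn⟩ := h
  exact ⟨n, fun ι _ _ hι A hA => hn ι hι A (hδ.trans hA)⟩

lemma DHJAt.option {α : Type} [Fintype α] [Nonempty α] (hα : ∀ δ : ℝ, 0 < δ → DHJAt α δ) (δ : ℝ)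
    (hδ : 0 < δ) : DHJAt (Option α) δ := by
  by_contra hcon
  set S : Set ℝ := {δ | DHJAt (Option α) δ ∧ 0 < δ} with hS
  have hlow : ∀ s ∈ S, δ ≤ s := fun s hs => by
    by_contra! h
    exact hcon (hs.1.mono h.le)
  have hbdd : BddBelow S := ⟨δ, hlow⟩
  have hne : S.Nonempty := ⟨2, ⟨0, fun ι _ _ _ A hA => by linarith [den_le_one A]⟩, by norm_num⟩
  have hpos : δ ≤ sInf S := le_csInf hne hlow
  refine not_critical_density hα (δ := sInf S) (by linarith) (fun ε hε => ?_) fun ε hε hε' h => ?_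
  · obtain ⟨s, hs, hs'⟩ := exists_lt_of_csInf_lt hne (show sInf S < sInf S + ε by linarith)
    exact hs.1.mono hs'.le
  · have := csInf_le hbdd (show sInf S - ε ∈ S from ⟨h, by linarith⟩)
    linarith

/-- The **density Hales-Jewett theorem**. -/
theorem exists_alphabet_dhj (k : ℕ) : ∃ (α : Type) (_ : Fintype α), Fintype.card α = k + 1 ∧
    ∀ δ : ℝ, 0 < δ → DHJAt α δ := by
  induction k with
  | zero =>
    refine ⟨Unit, inferInstance, by simp, fun δ hδ => ⟨1, fun ι _ _ hι A hA => ?_⟩⟩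
    obtain ⟨x, hx⟩ := nonempty_of_den_pos (hδ.trans_le hA)
    obtain ⟨i⟩ := Fintype.card_pos_iff.1 (show 0 < Fintype.card ι by omega)
    refine ⟨⟨fun _ => none, i, rfl⟩, fun a => ?_⟩
    convert hx
  | succ k ih =>
    obtain ⟨α, _, hcard, hα⟩ := ih
    have : Nonempty α := Fintype.card_pos_iff.1 (by omega)
    exact ⟨Option α, inferInstance, by simp [hcard], DHJAt.option hα⟩

/-- **Szemerédi's theorem** in Varnavides form, for functions on a cyclic group of prime order. -/
theorem szemeredi_varnavides (k : ℕ) {δ : ℝ} (hδ : 0 < δ) : ∃ c : ℝ, 0 < c ∧ ∃ M₀ : ℕ,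
    ∀ (M : ℕ) [Fact M.Prime], M₀ ≤ M → ∀ g : ZMod M → ℝ, (∀ x, 0 ≤ g x) → (∀ x, g x ≤ 1) →
      δ ≤ 𝔼 x, g x → c ≤ 𝔼 x : ZMod M, 𝔼 r : ZMod M, ∏ i ∈ range (k + 1), g (x + i * r) := by
  obtain ⟨α, _, hcard, hα⟩ := exists_alphabet_dhj k
  have e : α ≃ Fin (k + 1) := Fintype.equivFinOfCardEq hcard
  obtain ⟨n, hn⟩ := hα (δ / 2 / 2) (by linarith)
  have hc : (0 : ℝ) < Fintype.card (Fin n → Option α) := by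
    have : Nonempty (Fin n → Option α) := ⟨fun _ => none⟩
    exact Nat.cast_pos.2 Fintype.card_pos
  refine ⟨(δ / 2) ^ (k + 1) * (δ / 2 / 2 / Fintype.card (Fin n → Option α)), by positivity, n + 1,
    fun M _ hM g hg0 hg1 hg => ?_⟩
  have hA : δ / 2 ≤ den {x | δ / 2 ≤ g x} := by
    have := expect_le_den_add hg1 (c := δ / 2) (by linarith)
    linarith
  let B : ZMod M × ZMod M → Set (Fin n → α) := fun y =>
    {w | y.1 + y.2 * ((∑ j, (e (w j) : ℕ) : ℕ) : ZMod M) ∈ {x | δ / 2 ≤ g x}}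
  obtain ⟨l, hl⟩ := exists_common_line (Y := ZMod M × ZMod M) (δ := δ / 2) (by linarith)
    (hn (Fin n) (by simp)) B (by
      refine hA.trans_eq ?_
      simp only [B]
      generalize {x | δ / 2 ≤ g x} = A
      unfold den
      rw [expect_comm]
      symm
      have hne : Nonempty (Fin n → α) := ⟨fun _ => e.symm 0⟩
      rw [← Fintype.expect_const (ι := Fin n → α) (𝔼 x, ind (x ∈ A))]
      refine expect_congr rfl fun w _ => ?_
      rw [← univ_product_univ, expect_product, expect_comm,
        ← Fintype.expect_const (ι := ZMod M) (𝔼 x, ind (x ∈ A))]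
      refine expect_congr rfl fun d _ => ?_
      exact Fintype.expect_equiv (Equiv.addRight (d * ((∑ j, (e (w j) : ℕ) : ℕ) : ZMod M))) _ _
        fun a => rfl)
  set s : ℕ := ∑ j, (l.idxFun j).elim 0 (fun a => (e a : ℕ)) with hs
  set t : ℕ := ∑ j, (l.idxFun j).elim 1 (fun _ => 0) with ht
  have ht0 : 0 < t := by
    obtain ⟨j, hj⟩ := l.proper
    refine lt_of_lt_of_le ?_ (single_le_sum
      (f := fun j => (l.idxFun j).elim 1 (fun _ => 0)) (fun _ _ => Nat.zero_le _) (mem_univ j))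
    simp [hj]
  have htM : t < M := by
    refine lt_of_le_of_lt ?_ (show n < M by omega)
    calc t ≤ ∑ _j : Fin n, 1 := sum_le_sum fun j _ => by rcases l.idxFun j <;> simp
      _ = n := by simp
  have ht1 : ((t : ℕ) : ZMod M) ≠ 0 := by
    rw [Ne, ZMod.natCast_eq_zero_iff]
    exact Nat.not_dvd_of_pos_of_lt ht0 htM
  have hval : ∀ b, ∑ j, (e (l b j) : ℕ) = s + t * (e b : ℕ) := by
    intro b
    rw [hs, ht, sum_mul, ← sum_add_distrib]
    refine sum_congr rfl fun j _ => ?_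
    rcases hj : l.idxFun j with _ | a <;> simp [hj]
  have hcount : 𝔼 x : ZMod M, 𝔼 r : ZMod M, ∏ i ∈ range (k + 1), g (x + i * r) =
      𝔼 y : ZMod M × ZMod M, ∏ i ∈ range (k + 1), g (y.1 + y.2 * s + i * (y.2 * t)) := by
    rw [← univ_product_univ, expect_product, expect_comm]
    rw [expect_comm (s := univ (α := ZMod M)) (t := univ (α := ZMod M))
      (f := fun a d => ∏ i ∈ range (k + 1), g (a + d * s + i * (d * t)))]
    symm
    refine Fintype.expect_equiv (Equiv.mulRight₀ (t : ZMod M) ht1) _ _ fun d => ?_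
    refine Fintype.expect_equiv (Equiv.addRight (d * (s : ZMod M))) _ _ fun a => ?_
    simp
  rw [hcount]
  calc _ ≤ (δ / 2) ^ (k + 1) * den {y | ∀ a, l a ∈ B y} := by gcongr
    _ ≤ _ := by
      unfold den
      rw [mul_expect]
      refine expect_le_expect fun y _ => ?_
      generalize hP : {y | ∀ a, l a ∈ B y} = P
      by_cases hy : y ∈ P
      · rw [ind_true hy, mul_one, ← card_range (k + 1), ← prod_const, card_range]
        refine prod_le_prod (fun _ _ => by positivity) fun i hi => ?_
        rw [← hP] at hy
        have := hy (e.symm ⟨i, mem_range.1 hi⟩)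
        change δ / 2 ≤ g (y.1 + y.2 * ((∑ j, (e (l _ j) : ℕ) : ℕ) : ZMod M)) at this
        rw [hval] at this
        simp only [Equiv.apply_symm_apply] at this
        refine this.trans_eq (congrArg g ?_)
        push_cast
        ring
      · rw [ind_false hy, mul_zero]
        exact prod_nonneg fun _ _ => hg0 _

section Transference

variable {I : Type} [Fintype I] [DecidableEq I] {G : Type} [Fintype G]

lemma expect_pair {α β : Type} [Fintype α] [Fintype β] (F : α → β → ℝ) :
    𝔼 x, 𝔼 y, F x y = 𝔼 p : α × β, F p.1 p.2 := by
  rw [← univ_product_univ, expect_product]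

lemma expect_resample (i : I) (F : (I → G) → ℝ) :
    𝔼 x, F x = 𝔼 x, 𝔼 a, F (Function.update x i a) := by
  rw [expect_comm]
  have hb : ∀ a b : G, 𝔼 x, F (Function.update x i a) * (if x i = b then 1 else 0) =
      𝔼 x, F x * (if x i = a then 1 else 0) := by
    intro a b
    simp only [mul_ite, mul_one, mul_zero]
    rw [Fintype.expect_eq_sum_div_card, Fintype.expect_eq_sum_div_card, ← sum_filter, ← sum_filter]
    congr 1
    refine sum_nbij' (fun x => Function.update x i a) (fun x => Function.update x i b) ?_ ?_ ?_ ?_ ?_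
    · intro x hx; simp
    · intro x hx; simp
    · intro x hx
      simp only [mem_filter, mem_univ, true_and] at hx
      simp [← hx]
    · intro x hx
      simp only [mem_filter, mem_univ, true_and] at hx
      simp [← hx]
    · intro x hx; rfl
  have h1 : ∀ a, 𝔼 x, F (Function.update x i a) =
      ∑ b, 𝔼 x, F (Function.update x i a) * (if x i = b then 1 else 0) := by
    intro a
    rw [← expect_sum_comm]
    simp
  have h2 : 𝔼 x, F x = ∑ a, 𝔼 x, F x * (if x i = a then 1 else 0) := by
    rw [← expect_sum_comm]
    simp
  have h3 : ∀ a, 𝔼 x, F (Function.update x i a) =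
      Fintype.card G * 𝔼 x, F x * (if x i = a then 1 else 0) := by
    intro a
    rw [h1, sum_congr rfl fun b _ => hb a b]
    simp
  simp_rw [h3]
  rw [← mul_expect, Fintype.card_mul_expect, h2]

/-- The linear forms condition for weights indexed by `I`, written with interpolated points. -/
def LFC (ν : I → (I → G) → ℝ) (η : ℝ) : Prop :=
  ∀ t : Finset (I × Finset I), (∀ p ∈ t, p.1 ∉ p.2) →
    |(𝔼 x : I → G, 𝔼 y : I → G, ∏ p ∈ t, ν p.1 (p.2.piecewise y x)) - 1| ≤ η

/-- `h` does not depend on the coordinate `j`. -/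
def Indep (j : I) (h : (I → G) → ℝ) : Prop := ∀ x a, h (Function.update x j a) = h x

lemma LFC.mono {ν : I → (I → G) → ℝ} {η η' : ℝ} (h : LFC ν η) (hη : η ≤ η') : LFC ν η' :=
  fun t ht => (h t ht).trans hη

lemma LFC.expand {ν : I → (I → G) → ℝ} {η : ℝ} (h : LFC ν η) (s : Finset (I × Finset I))
    (hs : ∀ p ∈ s, p.1 ∉ p.2) (b : I × Finset I → ℝ) (hb : ∀ p, |b p| ≤ 1) :
    |(𝔼 x : I → G, 𝔼 y : I → G, ∏ p ∈ s, (ν p.1 (p.2.piecewise y x) + b p)) -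
      ∏ p ∈ s, (1 + b p)| ≤ 2 ^ s.card * η := by
  have e1 : (𝔼 x : I → G, 𝔼 y : I → G, ∏ p ∈ s, (ν p.1 (p.2.piecewise y x) + b p)) -
      ∏ p ∈ s, (1 + b p) = ∑ t ∈ s.powerset,
        ((𝔼 x : I → G, 𝔼 y : I → G, ∏ p ∈ t, ν p.1 (p.2.piecewise y x)) - 1) *
          ∏ p ∈ s \ t, b p := by
    simp_rw [Finset.prod_add, expect_sum_comm, sub_mul, sum_sub_distrib, expect_mul]
    simp
  rw [e1]
  refine (abs_sum_le_sum_abs _ _).trans ?_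
  have h2 : ∀ t ∈ s.powerset,
      |((𝔼 x : I → G, 𝔼 y : I → G, ∏ p ∈ t, ν p.1 (p.2.piecewise y x)) - 1) *
          ∏ p ∈ s \ t, b p| ≤ η := by
    intro t ht
    have ht' := h t fun p hp => hs p (mem_powerset.1 ht hp)
    rw [abs_mul, abs_prod]
    calc _ ≤ η * 1 := mul_le_mul ht' (prod_le_one (fun _ _ => abs_nonneg _) fun p _ => hb p)
          (prod_nonneg fun _ _ => abs_nonneg _) ((abs_nonneg _).trans ht')
      _ = η := mul_one _
  calc _ ≤ ∑ t ∈ s.powerset, η := sum_le_sum h2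
    _ = _ := by simp

lemma expect_sq_le_of_indep (i : I) (A W B : (I → G) → (I → G) → ℝ)
    (hAx : ∀ x y a, A (Function.update x i a) y = A x y)
    (hWx : ∀ x y a, W (Function.update x i a) y = W x y)
    (hWy : ∀ x y a, W x (Function.update y i a) = W x y)
    (hBy : ∀ x y a, B x (Function.update y i a) = B x y)
    (hAW : ∀ x y, |A x y| ≤ W x y) :
    (𝔼 x, 𝔼 y, A x y * B x y) ^ 2 ≤ (𝔼 x, 𝔼 y, W x y) *
      𝔼 x, 𝔼 y, W x y * (B x y * B (Function.update x i (y i)) y) := by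
  set H : (I → G) → (I → G) → ℝ := fun x y => 𝔼 a, B (Function.update x i a) y with hH
  have hW0 : ∀ x y, 0 ≤ W x y := fun x y => (abs_nonneg _).trans (hAW x y)
  have e1 : (𝔼 x, 𝔼 y, A x y * B x y) = 𝔼 x, 𝔼 y, A x y * H x y := by
    rw [expect_resample i]
    refine expect_congr rfl fun x _ => ?_
    rw [expect_comm]
    refine expect_congr rfl fun y _ => ?_
    simp only [hAx, hH, mul_expect]
  have e2 : (𝔼 x, 𝔼 y, W x y * (B x y * B (Function.update x i (y i)) y)) =
      𝔼 x, 𝔼 y, W x y * (H x y) ^ 2 := by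
    rw [expect_resample i]
    refine expect_congr rfl fun x _ => ?_
    have : ∀ a : G, (𝔼 y, W (Function.update x i a) y * (B (Function.update x i a) y *
        B (Function.update (Function.update x i a) i (y i)) y)) =
        𝔼 y, 𝔼 b, W x y * (B (Function.update x i a) y * B (Function.update x i b) y) := by
      intro a
      rw [expect_resample i]
      simp only [hWx, hWy, hBy, Function.update_idem, Function.update_self]
    simp_rw [this]
    rw [expect_comm]
    refine expect_congr rfl fun y _ => ?_
    simp_rw [hH, sq, expect_mul_expect, mul_expect]
  rw [e1, e2]
  have h1 : |𝔼 x, 𝔼 y, A x y * H x y| ≤ 𝔼 x, 𝔼 y, √(W x y) * (√(W x y) * |H x y|) := by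
    refine (abs_expect_le _ _).trans (expect_le_expect fun x _ => ?_)
    refine (abs_expect_le _ _).trans (expect_le_expect fun y _ => ?_)
    rw [abs_mul, ← mul_assoc, Real.mul_self_sqrt (hW0 x y)]
    exact mul_le_mul_of_nonneg_right (hAW x y) (abs_nonneg _)
  calc _ ≤ (𝔼 x, 𝔼 y, √(W x y) * (√(W x y) * |H x y|)) ^ 2 := by
        rw [← sq_abs]
        exact pow_le_pow_left₀ (abs_nonneg _) h1 2
    _ ≤ _ := by
        rw [expect_pair, expect_pair, expect_pair]
        refine (expect_mul_sq_le_sq_mul_sq _ _ _).trans (le_of_eq ?_)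
        simp [mul_pow, Real.sq_sqrt, hW0]

/-- The product of `F` over the vertices of the cube spanned by `x` and `y` in the directions
`ω`. -/
def cubeProd (ω : Finset I) (F : (I → G) → (I → G) → ℝ) (x y : I → G) : ℝ :=
  ∏ τ ∈ ω.powerset, F (τ.piecewise y x) y

lemma piecewise_update_swap {i : I} {τ : Finset I} (hi : i ∉ τ) (x y : I → G) :
    τ.piecewise y (Function.update x i (y i)) = (insert i τ).piecewise y x := by
  rw [piecewise_insert, update_piecewise_of_notMem _ _ _ hi]

lemma cubeProd_insert {i : I} {ω : Finset I} (hi : i ∉ ω) (F : (I → G) → (I → G) → ℝ)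
    (x y : I → G) : cubeProd ω F x y * cubeProd ω F (Function.update x i (y i)) y =
      cubeProd (insert i ω) F x y := by
  unfold cubeProd
  rw [prod_powerset_insert hi]
  congr 1
  refine prod_congr rfl fun τ hτ => ?_
  rw [piecewise_update_swap fun h => hi (mem_powerset.1 hτ h)]

lemma cubeProd_update_left {i : I} {ω : Finset I} (hi : i ∉ ω) {F : (I → G) → (I → G) → ℝ}
    (hF : ∀ x y a, F (Function.update x i a) y = F x y) (x y : I → G) (a : G) :
    cubeProd ω F (Function.update x i a) y = cubeProd ω F x y := by
  refine prod_congr rfl fun τ hτ => ?_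
  rw [← update_piecewise_of_notMem _ _ _ fun h => hi (mem_powerset.1 hτ h), hF]

lemma cubeProd_update_right {i : I} {ω : Finset I} (hi : i ∉ ω) {F : (I → G) → (I → G) → ℝ}
    (hF : ∀ x y a, F x (Function.update y i a) = F x y) (x y : I → G) (a : G) :
    cubeProd ω F x (Function.update y i a) = cubeProd ω F x y := by
  refine prod_congr rfl fun τ hτ => ?_
  rw [hF]
  congr 1
  refine piecewise_congr _ (fun l hl => ?_) fun _ _ => rfl
  have hli : l ≠ i := fun h => hi (mem_powerset.1 hτ (h ▸ hl))
  exact Function.update_of_ne hli _ _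

/-- The intermediate products in the successive elimination of the factors `R l`. -/
def elimProd (N : (I → G) → (I → G) → ℝ) (R w : I → (I → G) → (I → G) → ℝ) (ω ρ : Finset I)
    (x y : I → G) : ℝ :=
  cubeProd ω N x y * (∏ l ∈ ρ, cubeProd ω (R l) x y) *
    ∏ l ∈ ω, cubeProd (ω.erase l) (w l) x y

lemma elimProd_sq_le {N : (I → G) → (I → G) → ℝ} {R w : I → (I → G) → (I → G) → ℝ}
    {ω ρ : Finset I} {i : I} (hiω : i ∉ ω) (hiρ : i ∉ ρ)
    (hN : ∀ x y a, N x (Function.update y i a) = N x y)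
    (hRy : ∀ l x y a, R l x (Function.update y i a) = R l x y)
    (hwy : ∀ l x y a, w l x (Function.update y i a) = w l x y)
    (hRx : ∀ x y a, R i (Function.update x i a) y = R i x y)
    (hwx : ∀ x y a, w i (Function.update x i a) y = w i x y)
    (hRw : ∀ x y, |R i x y| ≤ w i x y) :
    (𝔼 x, 𝔼 y, elimProd N R w ω (insert i ρ) x y) ^ 2 ≤
      (𝔼 x, 𝔼 y, cubeProd ω (w i) x y) * 𝔼 x, 𝔼 y, elimProd N R w (insert i ω) ρ x y := by
  have key := expect_sq_le_of_indep i (cubeProd ω (R i)) (cubeProd ω (w i))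
    (elimProd N R w ω ρ) (cubeProd_update_left hiω hRx) (cubeProd_update_left hiω hwx)
    (cubeProd_update_right hiω (hwy i)) ?_ ?_
  · convert key using 6 with x _ y _ x _ y
    · unfold elimProd
      rw [prod_insert hiρ]
      ring
    · unfold elimProd
      rw [prod_insert hiω, erase_insert hiω]
      have h3 : ∏ l ∈ ω, cubeProd ((insert i ω).erase l) (w l) x y =
          (∏ l ∈ ω, cubeProd (ω.erase l) (w l) x y) *
            ∏ l ∈ ω, cubeProd (ω.erase l) (w l) (Function.update x i (y i)) y := by
        rw [← prod_mul_distrib]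
        refine prod_congr rfl fun l hl => ?_
        have hil : i ≠ l := fun h => hiω (h ▸ hl)
        rw [erase_insert_of_ne hil, cubeProd_insert fun h => hiω (mem_of_mem_erase h)]
      rw [h3, ← cubeProd_insert hiω]
      simp_rw [← cubeProd_insert hiω]
      rw [prod_mul_distrib]
      ring
  · intro x y a
    unfold elimProd
    rw [cubeProd_update_right hiω hN]
    congr 1
    · congr 1
      exact prod_congr rfl fun l _ => cubeProd_update_right hiω (hRy l) _ _ _
    · exact prod_congr rfl fun l _ =>
        cubeProd_update_right (fun h => hiω (mem_of_mem_erase h)) (hwy l) _ _ _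
  · intro x y
    unfold cubeProd
    rw [abs_prod]
    exact prod_le_prod (fun _ _ => abs_nonneg _) fun _ _ => hRw _ _

end Transference

section Transference

variable {I : Type} [Fintype I] [DecidableEq I]

/-- The weight dominating the factor with index `l` and its translate in direction `j`. -/
def pairWeight {G : Type} (ν : I → (I → G) → ℝ) (j l : I) (x y : I → G) : ℝ :=
  (ν l x + 1) * (ν l (Function.update x j (y j)) + 1)

lemma cubeProd_pairWeight {G : Type} (ν : I → (I → G) → ℝ) {j : I} (l : I) {ω : Finset I}
    (hj : j ∉ ω) (x y : I → G) :
    cubeProd ω (pairWeight ν j l) x y =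
      ∏ τ ∈ (insert j ω).powerset, (ν l (τ.piecewise y x) + 1) := by
  unfold cubeProd pairWeight
  rw [prod_powerset_insert hj, prod_mul_distrib]
  congr 1
  exact prod_congr rfl fun τ _ => by rw [piecewise_insert]

variable {G : Type} [Fintype G]

lemma LFC.expect_pairWeight_le {ν : I → (I → G) → ℝ} {η : ℝ} (h : LFC ν η)
    (hη : η ≤ 1) {j l : I} (hjl : l ≠ j) {ω : Finset I} (hj : j ∉ ω) (hl : l ∉ ω) :
    (𝔼 x, 𝔼 y, cubeProd ω (pairWeight ν j l) x y) ≤ 2 * 2 ^ 2 ^ Fintype.card I := by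
  have h1 := h.expand (({l} : Finset I) ×ˢ (insert j ω).powerset) (by
    intro p hp
    simp only [mem_product, mem_singleton, mem_powerset] at hp
    intro hmem
    rcases mem_insert.1 (hp.2 hmem) with h' | h'
    · exact hjl (hp.1 ▸ h')
    · exact hl (hp.1 ▸ h')) (fun _ => 1) (by simp)
  simp only [prod_product, prod_singleton, card_product, card_singleton, one_mul, prod_const] at h1
  simp_rw [cubeProd_pairWeight ν l hj]
  have h2 := (abs_le.1 h1).2
  have h3 : (insert j ω).powerset.card ≤ 2 ^ Fintype.card I := by
    rw [card_powerset]
    exact Nat.pow_le_pow_right (by norm_num) (card_le_univ _)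
  have h4 : (2 : ℝ) ^ (insert j ω).powerset.card ≤ 2 ^ 2 ^ Fintype.card I :=
    pow_le_pow_right₀ (by norm_num) h3
  have h5 : (2 : ℝ) ^ (insert j ω).powerset.card * η ≤ 2 ^ (insert j ω).powerset.card :=
    mul_le_of_le_one_right (by positivity) hη
  rw [one_add_one_eq_two] at h2
  linarith

lemma LFC.abs_elimProd_le {ν : I → (I → G) → ℝ} {η : ℝ} (h : LFC ν η) (j : I)
    (R : I → (I → G) → (I → G) → ℝ) :
    |𝔼 x, 𝔼 y, elimProd (fun x _ => ν j x - 1) R (pairWeight ν j) (univ.erase j) ∅ x y| ≤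
      2 ^ (univ.filter fun p : I × Finset I => p.1 ∉ p.2).card * η := by
  have h1 := h.expand (univ.filter fun p : I × Finset I => p.1 ∉ p.2) (by simp)
    (fun p => if p.1 = j then -1 else 1) (by intro p; split_ifs <;> simp)
  have h0 : ∏ p ∈ univ.filter (fun p : I × Finset I => p.1 ∉ p.2),
      (1 + (if p.1 = j then -1 else 1 : ℝ)) = 0 :=
    prod_eq_zero (i := (j, ∅)) (by simp) (by simp)
  rw [h0, sub_zero] at h1
  convert h1 using 5 with x _ y
  rw [prod_finset_product' _ univ (fun l => (univ.erase l).powerset)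
    (f := fun l τ => ν l (τ.piecewise y x) + (if l = j then -1 else 1)) (by
      rintro ⟨l, τ⟩
      simp [subset_erase])]
  unfold elimProd
  rw [← mul_prod_erase univ _ (mem_univ j)]
  simp only [prod_empty, mul_one, if_true]
  congr 1
  refine prod_congr rfl fun l hl => ?_
  have hlj : l ≠ j := ne_of_mem_erase hl
  rw [cubeProd_pairWeight ν l (by simp), if_neg hlj]
  have : insert j ((univ.erase j).erase l) = univ.erase l := by
    rw [erase_right_comm, insert_erase]
    simp [hlj.symm]
  rw [this]

lemma exists_elimProd_small (j : I) (ρ : Finset I) : ∀ ε : ℝ, 0 < ε → ∃ η : ℝ, 0 < η ∧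
    ∀ (G : Type) [Fintype G] (ν : I → (I → G) → ℝ), (∀ l x, 0 ≤ ν l x) →
      (∀ l, Indep l (ν l)) → LFC ν η →
      ∀ R : I → (I → G) → (I → G) → ℝ, (∀ l x y, |R l x y| ≤ pairWeight ν j l x y) →
      (∀ l i, i ≠ j → ∀ x y a, R l x (Function.update y i a) = R l x y) →
      (∀ l, l ≠ j → ∀ x y a, R l (Function.update x l a) y = R l x y) →
      ∀ ω : Finset I, j ∉ ω → j ∉ ρ → Disjoint ω ρ → ω ∪ ρ = univ.erase j →
        |𝔼 x, 𝔼 y, elimProd (fun x _ => ν j x - 1) R (pairWeight ν j) ω ρ x y| ≤ ε := by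
  induction ρ using Finset.induction_on with
  | empty =>
    intro ε hε
    set K : ℝ := 2 ^ (univ.filter fun p : I × Finset I => p.1 ∉ p.2).card
    have hK : 0 < K := by positivity
    refine ⟨ε / K, by positivity, ?_⟩
    intro G _ ν hν hind hLF R hR hRy hRx ω hjω _ hd hu
    rw [union_empty] at hu
    subst hu
    exact (hLF.abs_elimProd_le j R).trans (le_of_eq (mul_div_cancel₀ _ hK.ne'))
  | insert i ρ hiρ ih =>
    intro ε hε
    set K : ℝ := 2 * 2 ^ 2 ^ Fintype.card I
    have hK : 0 < K := by positivity
    obtain ⟨η, hη, hmain⟩ := ih (ε ^ 2 / K) (by positivity)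
    refine ⟨min η 1, by positivity, ?_⟩
    intro G _ ν hν hind hLF R hR hRy hRx ω hjω hjρ hd hu
    have hij : i ≠ j := fun h => hjρ (h ▸ mem_insert_self _ _)
    have hiω : i ∉ ω := fun h => disjoint_left.1 hd h (mem_insert_self _ _)
    have h1 := hmain G ν hν hind (hLF.mono (min_le_left _ _)) R hR hRy hRx (insert i ω)
      (by simp [hij.symm, hjω]) (fun h => hjρ (mem_insert_of_mem h))
      (by
        rw [disjoint_insert_left]
        exact ⟨hiρ, hd.mono_right (subset_insert _ _)⟩)
      (by rw [← hu, insert_union, union_insert])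
    have h2 := elimProd_sq_le (N := fun x _ => ν j x - 1) (R := R) (w := pairWeight ν j) hiω hiρ
      (fun _ _ _ => rfl) (fun l => hRy l i hij)
      (fun l x y a => by simp [pairWeight, Function.update_of_ne hij.symm])
      (hRx i hij)
      (fun x y a => by
        unfold pairWeight
        rw [Function.update_comm hij, hind i, hind i]) (hR i)
    have h3 := hLF.expect_pairWeight_le (min_le_right _ _) hij hjω hiω
    have h4 : 0 ≤ 𝔼 x, 𝔼 y, cubeProd ω (pairWeight ν j i) x y :=
      expect_nonneg fun x _ => expect_nonneg fun y _ => prod_nonneg fun τ _ =>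
        mul_nonneg (add_nonneg (hν _ _) zero_le_one) (add_nonneg (hν _ _) zero_le_one)
    refine abs_le_of_sq_le_sq (h2.trans ?_) hε.le
    refine (mul_le_mul_of_nonneg_left ((le_abs_self _).trans h1) h4).trans ?_
    refine (mul_le_mul_of_nonneg_right h3 (by positivity)).trans (le_of_eq ?_)
    exact mul_div_cancel₀ _ hK.ne'

/-- A pseudorandom weight is close to `1` against products of functions of fewer variables which
are merely bounded by the other weights, even after doubling one variable. -/
theorem exists_doubled_correlation_small (j : I) : ∀ ε : ℝ, 0 < ε → ∃ η : ℝ, 0 < η ∧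
    ∀ (G : Type) [Fintype G] (ν : I → (I → G) → ℝ), (∀ l x, 0 ≤ ν l x) →
      (∀ l, Indep l (ν l)) → LFC ν η →
      ∀ P Q : I → (I → G) → ℝ, (∀ l x, |P l x| ≤ ν l x + 1) → (∀ l x, |Q l x| ≤ ν l x + 1) →
      (∀ l, l ≠ j → Indep l (P l)) → (∀ l, l ≠ j → Indep l (Q l)) →
        |𝔼 x, 𝔼 y : I → G, (ν j x - 1) *
          ∏ l ∈ univ.erase j, (P l x * Q l (Function.update x j (y j)))| ≤ ε := by
  intro ε hε
  obtain ⟨η, hη, hmain⟩ := exists_elimProd_small j (univ.erase j) ε hε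
  refine ⟨η, hη, ?_⟩
  intro G _ ν hν hind hLF P Q hP hQ hPi hQi
  have h1 := hmain G ν hν hind hLF (fun l x y => P l x * Q l (Function.update x j (y j)))
    (fun l x y => by
      rw [abs_mul]
      exact mul_le_mul (hP _ _) (hQ _ _) (abs_nonneg _) (add_nonneg (hν _ _) zero_le_one))
    (fun l i hij x y a => by simp [Function.update_of_ne hij.symm])
    (fun l hl x y a => by rw [Function.update_comm hl, hPi l hl, hQi l hl])
    ∅ (by simp) (by simp) (by simp) (by simp)
  simpa [elimProd, cubeProd] using h1

end Transference

section Transference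

variable {I : Type} [Fintype I] [DecidableEq I] {G : Type} [Fintype G]

/-- The average of `F` over the coordinate `j`. -/
def avgAt (j : I) (F : (I → G) → ℝ) (x : I → G) : ℝ := 𝔼 a, F (Function.update x j a)

lemma avgAt_indep (j : I) (F : (I → G) → ℝ) : Indep j (avgAt j F) := by
  intro x a
  simp [avgAt]

lemma expect_mul_avgAt {j : I} {u : (I → G) → ℝ} (hu : Indep j u) (F : (I → G) → ℝ) :
    𝔼 x, u x * F x = 𝔼 x, u x * avgAt j F x := by
  rw [expect_resample j]
  refine expect_congr rfl fun x _ => ?_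
  simp only [avgAt, mul_expect]
  exact expect_congr rfl fun a _ => by rw [hu]

lemma expect_doubled [Nonempty G] {j : I} {u : (I → G) → ℝ} (hu : Indep j u)
    (F H : (I → G) → ℝ) :
    𝔼 x, 𝔼 y : I → G, u x * (F x * H (Function.update x j (y j))) =
      𝔼 x, u x * (avgAt j F x * avgAt j H x) := by
  have h1 : ∀ x : I → G, 𝔼 y : I → G, u x * (F x * H (Function.update x j (y j))) =
      u x * avgAt j H x * F x := by
    intro x
    rw [expect_resample j]
    simp only [Function.update_self, Fintype.expect_const]
    rw [avgAt, mul_expect, expect_mul]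
    exact expect_congr rfl fun a _ => by ring
  simp_rw [h1]
  rw [expect_mul_avgAt (u := fun x => u x * avgAt j H x)]
  · exact expect_congr rfl fun x _ => by ring
  · intro x a
    simp only [hu x a, avgAt_indep j H x a]

lemma LFC.expect_le [Nonempty G] {ν : I → (I → G) → ℝ} {η : ℝ} (h : LFC ν η) (S : Finset I) :
    |(𝔼 x, ∏ i ∈ S, ν i x) - 1| ≤ η := by
  have := h (S ×ˢ {∅}) (by simp)
  simpa [prod_product] using this

lemma LFC.expect_doubled_le [Nonempty G] {ν : I → (I → G) → ℝ} {η : ℝ} (h : LFC ν η) {j : I}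
    {S : Finset I} (hj : j ∉ S) :
    |(𝔼 x, avgAt j (fun x => ∏ i ∈ S, ν i x) x * avgAt j (fun x => ∏ i ∈ S, ν i x) x) - 1|
      ≤ η := by
  have := h (S ×ˢ {∅, {j}}) (by
    rintro ⟨i, τ⟩ hp
    simp only [mem_product, mem_insert, mem_singleton] at hp
    rcases hp with ⟨h1, rfl | rfl⟩
    · simp
    · simp only [mem_singleton]
      rintro rfl
      exact hj h1)
  have e := expect_doubled (G := G) (j := j) (u := fun _ => 1) (fun _ _ => rfl)
    (fun x => ∏ i ∈ S, ν i x) (fun x => ∏ i ∈ S, ν i x)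
  simp only [one_mul] at e
  rw [← e]
  simpa [prod_product, prod_pair, piecewise_singleton, prod_mul_distrib] using this

lemma expect_abs_sq_le (u v : (I → G) → ℝ) :
    (𝔼 x, |u x| * |v x|) ^ 2 ≤ (𝔼 x, u x * u x) * 𝔼 x, v x * v x := by
  refine (expect_mul_sq_le_sq_mul_sq _ _ _).trans (le_of_eq ?_)
  simp [sq]

/-- Only a small part of a function dominated by an average of pseudorandom weights lies above
`1`. -/
lemma LFC.expect_excess_le [Nonempty G] {ν : I → (I → G) → ℝ} {η : ℝ} (h : LFC ν η) (hη : η ≤ 1)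
    {j : I} {S : Finset I} (hj : j ∉ S) {F H : (I → G) → ℝ} (hF0 : ∀ x, 0 ≤ F x)
    (hFν : ∀ x, F x ≤ avgAt j (fun x => ∏ i ∈ S, ν i x) x)
    (hH0 : ∀ x, 0 ≤ H x) :
    𝔼 x, (F x - H x) * (F x - min (F x) 1) ≤ √(21 * η) := by
  set V := avgAt j (fun x => ∏ i ∈ S, ν i x) with hV
  have e1 : 𝔼 x, V x = 𝔼 x, ∏ i ∈ S, ν i x := by
    have := expect_mul_avgAt (G := G) (j := j) (u := fun _ => 1) (fun _ _ => rfl)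
      (fun x => ∏ i ∈ S, ν i x)
    simpa using this.symm
  have h1 := abs_le.1 (h.expect_le S)
  rw [← e1] at h1
  have h2 := abs_le.1 (h.expect_doubled_le hj)
  rw [← hV] at h2
  have h3 : 𝔼 x, (V x + 1) * (V x + 1) ≤ 7 := by
    have : 𝔼 x, (V x + 1) * (V x + 1) = (𝔼 x, V x * V x) + 2 * (𝔼 x, V x) + 1 := by
      rw [mul_expect, ← expect_add_distrib]
      nth_rw 3 [← Fintype.expect_const (ι := I → G) (1 : ℝ)]
      rw [← expect_add_distrib]
      exact expect_congr rfl fun x _ => by ring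
    linarith
  have h4 : 𝔼 x, (V x - 1) * (V x - 1) ≤ 3 * η := by
    have : 𝔼 x, (V x - 1) * (V x - 1) = (𝔼 x, V x * V x) - 2 * (𝔼 x, V x) + 1 := by
      rw [mul_expect, ← expect_sub_distrib]
      nth_rw 3 [← Fintype.expect_const (ι := I → G) (1 : ℝ)]
      rw [← expect_add_distrib]
      exact expect_congr rfl fun x _ => by ring
    linarith
  have h5 : 𝔼 x, (F x - H x) * (F x - min (F x) 1) ≤ 𝔼 x, |V x + 1| * |V x - 1| := by
    refine expect_le_expect fun x _ => ?_
    have hVx := hFν x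
    have h0 := hF0 x
    have h6 : F x - min (F x) 1 ≤ |V x - 1| := by
      rcases le_total (F x) 1 with h' | h'
      · rw [min_eq_left h', sub_self]
        exact abs_nonneg _
      · rw [min_eq_right h']
        exact (sub_le_sub_right hVx 1).trans (le_abs_self _)
    have h7 : 0 ≤ F x - min (F x) 1 := sub_nonneg.2 (min_le_left _ _)
    have h8 : F x - H x ≤ |V x + 1| := by
      have := le_abs_self (V x + 1)
      linarith [hH0 x]
    exact (mul_le_mul_of_nonneg_right h8 h7).trans (mul_le_mul_of_nonneg_left h6 (abs_nonneg _))
  refine h5.trans (Real.le_sqrt_of_sq_le ((expect_abs_sq_le _ _).trans ?_))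
  have h9 : 0 ≤ 𝔼 x, (V x - 1) * (V x - 1) := expect_nonneg fun x _ => mul_self_nonneg _
  calc _ ≤ 7 * (3 * η) := mul_le_mul h3 h4 h9 (by norm_num)
    _ = 21 * η := by ring

/-- `g` approximates `f` when tested against products of bounded functions of fewer variables. -/
def CutClose (f g : I → (I → G) → ℝ) (η : ℝ) : Prop :=
  ∀ j, ∀ u : I → (I → G) → ℝ, (∀ i, Indep i (u i)) → (∀ i x, |u i x| ≤ 1) →
    |𝔼 x, (f j x - g j x) * ∏ i ∈ univ.erase j, u i x| ≤ η

end Transference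

section Transference

variable {I : Type} [Fintype I] [DecidableEq I]

lemma expect_mul_sq_sub_le {G : Type} [Fintype G] [Nonempty G] {ν : I → (I → G) → ℝ} {ε : ℝ}
    (hind : ∀ l, Indep l (ν l)) {j : I} {P Q : I → (I → G) → ℝ}
    (hP : ∀ l, l ≠ j → Indep l (P l)) (hQ : ∀ l, l ≠ j → Indep l (Q l))
    (hPν : ∀ l x, |P l x| ≤ ν l x + 1) (hQν : ∀ l x, |Q l x| ≤ ν l x + 1)
    (hsmall : ∀ P Q : I → (I → G) → ℝ, (∀ l x, |P l x| ≤ ν l x + 1) →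
      (∀ l x, |Q l x| ≤ ν l x + 1) → (∀ l, l ≠ j → Indep l (P l)) →
      (∀ l, l ≠ j → Indep l (Q l)) →
        |𝔼 x, 𝔼 y : I → G, (ν j x - 1) *
          ∏ l ∈ univ.erase j, (P l x * Q l (Function.update x j (y j)))| ≤ ε) :
    𝔼 x, ν j x * (avgAt j (fun x => ∏ l ∈ univ.erase j, P l x) x -
        avgAt j (fun x => ∏ l ∈ univ.erase j, Q l x) x) ^ 2 ≤
      4 * ε + 𝔼 x, (avgAt j (fun x => ∏ l ∈ univ.erase j, P l x) x -
        avgAt j (fun x => ∏ l ∈ univ.erase j, Q l x) x) ^ 2 := by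
  set F := avgAt j (fun x => ∏ l ∈ univ.erase j, P l x) with hF
  set H := avgAt j (fun x => ∏ l ∈ univ.erase j, Q l x) with hH
  have hu : Indep j fun x => ν j x - 1 := fun x a => by simp only [hind j x a]
  have h1 := hsmall P P hPν hPν hP hP
  have h2 := hsmall P Q hPν hQν hP hQ
  have h3 := hsmall Q Q hQν hQν hQ hQ
  simp_rw [prod_mul_distrib] at h1 h2 h3
  have e1 := expect_doubled hu (fun x => ∏ l ∈ univ.erase j, P l x)
    (fun x => ∏ l ∈ univ.erase j, P l x)
  have e2 := expect_doubled hu (fun x => ∏ l ∈ univ.erase j, P l x)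
    (fun x => ∏ l ∈ univ.erase j, Q l x)
  have e3 := expect_doubled hu (fun x => ∏ l ∈ univ.erase j, Q l x)
    (fun x => ∏ l ∈ univ.erase j, Q l x)
  rw [e1] at h1
  rw [e2] at h2
  rw [e3] at h3
  have e : 𝔼 x, ν j x * (F x - H x) ^ 2 = (𝔼 x, (ν j x - 1) * (F x * F x)) -
      2 * (𝔼 x, (ν j x - 1) * (F x * H x)) + (𝔼 x, (ν j x - 1) * (H x * H x)) +
      𝔼 x, (F x - H x) ^ 2 := by
    rw [mul_expect, ← expect_sub_distrib, ← expect_add_distrib, ← expect_add_distrib]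
    exact expect_congr rfl fun x _ => by ring
  rw [e]
  have := abs_le.1 h1
  have := abs_le.1 h2
  have := abs_le.1 h3
  linarith

lemma indep_piecewise [DecidableEq I] {G : Type} {f h : I → (I → G) → ℝ} (S : Finset I)
    (hf : ∀ i, Indep i (f i)) (hh : ∀ i, Indep i (h i)) (i : I) :
    Indep i (S.piecewise f h i) := by
  unfold Finset.piecewise
  split_ifs
  exacts [hf i, hh i]

/-- **Relative counting lemma.** -/
theorem exists_counting (S : Finset I) : ∀ ε : ℝ, 0 < ε → ∃ η : ℝ, 0 < η ∧
    ∀ (G : Type) [Fintype G] [Nonempty G] (ν f g : I → (I → G) → ℝ),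
      (∀ l, Indep l (ν l)) → LFC ν η → (∀ l, Indep l (f l)) → (∀ l, Indep l (g l)) →
      (∀ l x, 0 ≤ f l x) → (∀ l x, f l x ≤ ν l x) → (∀ l x, 0 ≤ g l x) → (∀ l x, g l x ≤ 1) →
      CutClose f g η →
      ∀ h : I → (I → G) → ℝ, (∀ l, Indep l (h l)) → (∀ l x, 0 ≤ h l x) → (∀ l x, h l x ≤ 1) →
        |(𝔼 x, ∏ i, S.piecewise f h i x) - 𝔼 x, ∏ i, S.piecewise g h i x| ≤ ε := by
  induction S using Finset.induction_on with
  | empty =>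
    intro ε hε
    exact ⟨1, one_pos, by intros; simpa using hε.le⟩
  | insert j S hj ih =>
    intro ε hε
    obtain ⟨η₁, hη₁, H₁⟩ := exists_doubled_correlation_small j (ε ^ 2 / 96) (by positivity)
    obtain ⟨η₂, hη₂, H₂⟩ := ih (ε ^ 2 / 48) (by positivity)
    set η₃ := (ε ^ 2 / 24) ^ 2 / 21 with hη₃
    have hη₃0 : 0 < η₃ := by positivity
    refine ⟨min (min η₁ η₂) (min η₃ (min (ε / 2) 1)), by positivity, ?_⟩
    set η := min (min η₁ η₂) (min η₃ (min (ε / 2) 1)) with hη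
    have l1 : η ≤ η₁ := (min_le_left _ _).trans (min_le_left _ _)
    have l2 : η ≤ η₂ := (min_le_left _ _).trans (min_le_right _ _)
    have l3 : η ≤ η₃ := (min_le_right _ _).trans (min_le_left _ _)
    have l4 : η ≤ ε / 2 := (min_le_right _ _).trans ((min_le_right _ _).trans (min_le_left _ _))
    have l5 : η ≤ 1 := (min_le_right _ _).trans ((min_le_right _ _).trans (min_le_right _ _))
    clear_value η
    intro G _ _ ν f g hνi hLF hfi hgi hf0 hfν hg0 hg1 hcut h hhi hh0 hh1
    have hν0 : ∀ l x, 0 ≤ ν l x := fun l x => (hf0 l x).trans (hfν l x)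
    set P : I → (I → G) → ℝ := S.piecewise f h with hP
    set Q : I → (I → G) → ℝ := S.piecewise g h with hQ
    have hPi : ∀ i, Indep i (P i) := indep_piecewise S hfi hhi
    have hQi : ∀ i, Indep i (Q i) := indep_piecewise S hgi hhi
    have hP0 : ∀ i x, 0 ≤ P i x := by
      intro i x
      rw [hP]
      by_cases hi : i ∈ S <;> simp [hi, hf0, hh0]
    have hQ0 : ∀ i x, 0 ≤ Q i x := by
      intro i x
      rw [hQ]
      by_cases hi : i ∈ S <;> simp [hi, hg0, hh0]
    have hQ1 : ∀ i x, Q i x ≤ 1 := by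
      intro i x
      rw [hQ]
      by_cases hi : i ∈ S <;> simp [hi, hg1, hh1]
    have hPν : ∀ i x, |P i x| ≤ ν i x + 1 := by
      intro i x
      rw [abs_of_nonneg (hP0 i x), hP]
      by_cases hi : i ∈ S
      · simp only [hi, piecewise_eq_of_mem]
        linarith [hfν i x]
      · simp only [hi, not_false_iff, piecewise_eq_of_notMem]
        linarith [hh1 i x, hν0 i x]
    have hQν : ∀ i x, |Q i x| ≤ ν i x + 1 := by
      intro i x
      rw [abs_of_nonneg (hQ0 i x)]
      linarith [hQ1 i x, hν0 i x]
    set F := avgAt j (fun x => ∏ l ∈ univ.erase j, P l x) with hF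
    set H := avgAt j (fun x => ∏ l ∈ univ.erase j, Q l x) with hH
    have hF0 : ∀ x, 0 ≤ F x := fun x => expect_nonneg fun a _ => prod_nonneg fun i _ => hP0 i _
    have hH0 : ∀ x, 0 ≤ H x := fun x => expect_nonneg fun a _ => prod_nonneg fun i _ => hQ0 i _
    have hH1 : ∀ x, H x ≤ 1 := fun x => Finset.expect_le Finset.univ_nonempty fun a _ =>
      prod_le_one (fun i _ => hQ0 i _) fun i _ => hQ1 i _
    have hFν : ∀ x, F x ≤ avgAt j (fun x => ∏ i ∈ S, ν i x) x := by
      intro x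
      refine expect_le_expect fun a _ => ?_
      have hS : univ.erase j ∩ S = S := by
        rw [erase_inter, univ_inter, erase_eq_of_notMem hj]
      change _ ≤ ∏ i ∈ S, ν i (Function.update x j a)
      rw [← hS, ← prod_ite_mem]
      refine prod_le_prod (fun i _ => hP0 i _) fun i _ => ?_
      rw [hP]
      by_cases hi : i ∈ S <;> simp [hi, hfν, hh1]
    have hFi : Indep j F := avgAt_indep _ _
    have hHi : Indep j H := avgAt_indep _ _
    -- products with one factor in position `j` singled out
    have hprod : ∀ (p u : I → (I → G) → ℝ) (w : (I → G) → ℝ), (∀ i, i ≠ j → u i = p i) → u j = w →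
        ∀ x, ∏ i, u i x = w x * ∏ i ∈ univ.erase j, p i x := by
      intro p u w h1 h2 x
      rw [← mul_prod_erase univ _ (mem_univ j), h2]
      congr 1
      exact prod_congr rfl fun i hi => by rw [h1 i (ne_of_mem_erase hi)]
    have E : ∀ (p u : I → (I → G) → ℝ) (w : (I → G) → ℝ), (∀ i, i ≠ j → u i = p i) → u j = w →
        Indep j w → 𝔼 x, ∏ i, u i x = 𝔼 x, w x * avgAt j (fun x => ∏ i ∈ univ.erase j, p i x) x := by
      intro p u w h1 h2 h3
      simp_rw [hprod p u w h1 h2]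
      exact expect_mul_avgAt h3 _
    have ef : 𝔼 x, ∏ i, (insert j S).piecewise f h i x = 𝔼 x, f j x * F x :=
      E P _ _ (fun i hi => piecewise_insert_of_ne _ _ _ hi) (by simp) (hfi j)
    have eg : 𝔼 x, ∏ i, (insert j S).piecewise g h i x = 𝔼 x, g j x * H x :=
      E Q _ _ (fun i hi => piecewise_insert_of_ne _ _ _ hi) (by simp) (hgi j)
    have hIH : ∀ m : (I → G) → ℝ, Indep j m → (∀ x, 0 ≤ m x) → (∀ x, m x ≤ 1) →
        |(𝔼 x, m x * F x) - 𝔼 x, m x * H x| ≤ ε ^ 2 / 48 := by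
      intro m hm hm0 hm1
      have := H₂ G ν f g hνi (hLF.mono l2) hfi hgi hf0 hfν hg0 hg1
        (fun i u a b => (hcut i u a b).trans l2) (Function.update h j m)
        (by
          intro l
          by_cases hl : l = j
          · subst hl; simpa using hm
          · simpa [hl] using hhi l)
        (by
          intro l
          by_cases hl : l = j
          · subst hl; simpa using hm0
          · simpa [hl] using hh0 l)
        (by
          intro l
          by_cases hl : l = j
          · subst hl; simpa using hm1
          · simpa [hl] using hh1 l)
      rw [E P _ m ?_ ?_ hm, E Q _ m ?_ ?_ hm] at this
      · exact this
      · intro i hi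
        simp [hQ, Finset.piecewise, hi]
      · simp [hj]
      · intro i hi
        simp [hP, Finset.piecewise, hi]
      · simp [hj]
    have hd : 𝔼 x, (F x - H x) ^ 2 ≤ ε ^ 2 / 12 := by
      set m : (I → G) → ℝ := fun x => min (F x) 1 with hm
      have a1 := abs_le.1 (hIH m (fun x a => by simp only [hm, hFi x a])
        (fun x => le_min (hF0 x) zero_le_one) (fun x => min_le_right _ _))
      have a2 := abs_le.1 (hIH H hHi hH0 hH1)
      have a3 : 𝔼 x, (F x - H x) * (F x - m x) ≤ √(21 * η) :=
        hLF.expect_excess_le l5 hj hF0 hFν hH0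
      have a4 : √(21 * η) ≤ ε ^ 2 / 24 := by
        refine Real.sqrt_le_iff.2 ⟨by positivity, ?_⟩
        rw [hη₃] at l3
        linarith
      have e : 𝔼 x, (F x - H x) ^ 2 = (𝔼 x, (F x - H x) * (F x - m x)) +
          ((𝔼 x, m x * F x) - 𝔼 x, m x * H x) - ((𝔼 x, H x * F x) - 𝔼 x, H x * H x) := by
        rw [← expect_sub_distrib, ← expect_sub_distrib, ← expect_add_distrib, ← expect_sub_distrib]
        exact expect_congr rfl fun x _ => by ring
      rw [e]
      linarith
    have hs := expect_mul_sq_sub_le hνi (fun l _ => hPi l) (fun l _ => hQi l) hPν hQν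
      (H₁ G ν hν0 hνi (hLF.mono l1))
    have hcs : (𝔼 x, f j x * (F x - H x)) ^ 2 ≤ (ε / 2) ^ 2 := by
      have b1 : |𝔼 x, f j x * (F x - H x)| ≤ 𝔼 x, √(ν j x) * (√(ν j x) * |F x - H x|) := by
        refine (abs_expect_le _ _).trans (expect_le_expect fun x _ => ?_)
        rw [abs_mul, ← mul_assoc, Real.mul_self_sqrt (hν0 j x), abs_of_nonneg (hf0 j x)]
        exact mul_le_mul_of_nonneg_right (hfν j x) (abs_nonneg _)
      have b2 : 𝔼 x, ν j x ≤ 2 := by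
        have := hLF.expect_le {j}
        simp only [prod_singleton] at this
        linarith [(abs_le.1 this).2]
      calc _ ≤ (𝔼 x, √(ν j x) * (√(ν j x) * |F x - H x|)) ^ 2 := by
            rw [← sq_abs]
            exact pow_le_pow_left₀ (abs_nonneg _) b1 2
        _ ≤ (𝔼 x, ν j x) * 𝔼 x, ν j x * (F x - H x) ^ 2 := by
            refine (expect_mul_sq_le_sq_mul_sq _ _ _).trans (le_of_eq ?_)
            simp [mul_pow, Real.sq_sqrt, hν0]
        _ ≤ 2 * (ε ^ 2 / 8) := by
            refine mul_le_mul b2 (by linarith) ?_ (by norm_num)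
            exact expect_nonneg fun x _ => mul_nonneg (hν0 j x) (sq_nonneg _)
        _ = _ := by ring
    have hcs' := abs_le.1 (abs_le_of_sq_le_sq hcs (by positivity))
    have hc : |𝔼 x, (f j x - g j x) * H x| ≤ η := by
      have := hcut j Q hQi fun i x => abs_le.2 ⟨by linarith [hQ0 i x], hQ1 i x⟩
      rwa [expect_mul_avgAt (u := fun x => f j x - g j x)] at this
      intro x a
      simp only [hfi j x a, hgi j x a]
    rw [ef, eg]
    have e : (𝔼 x, f j x * F x) - (𝔼 x, g j x * H x) =
        (𝔼 x, (f j x - g j x) * H x) + 𝔼 x, f j x * (F x - H x) := by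
      rw [← expect_sub_distrib, ← expect_add_distrib]
      exact expect_congr rfl fun x _ => by ring
    rw [e]
    have c1 := abs_le.1 hc
    exact abs_le.2 ⟨by linarith [hcs'.1], by linarith [hcs'.2]⟩

end Transference

lemma continuous_expect {Z G : Type} [TopologicalSpace Z] [Fintype G] {F : Z → G → ℝ}
    (h : ∀ x, Continuous fun z => F z x) : Continuous fun z => 𝔼 x, F z x := by
  simp only [Fintype.expect_eq_sum_div_card]
  exact (continuous_finsetSum _ fun x _ => h x).div_const _

/-- **Dense model theorem**, for compact classes of test functions. -/
lemma exists_dense_model_of_isCompact (ε : ℝ) (hε : 0 < ε) : ∃ ε' : ℝ, 0 < ε' ∧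
    ∀ (G : Type) [Fintype G] [Nonempty G] (C : Set (G → ℝ)), IsCompact C → Convex ℝ C →
      (1 : G → ℝ) ∈ C → (∀ φ ∈ C, ∀ x, |φ x| ≤ 1) → (∀ φ ∈ C, ∀ ψ ∈ C, φ * ψ ∈ C) →
      ∀ ν f : G → ℝ, (∀ x, 0 ≤ f x) → (∀ x, f x ≤ ν x) →
      (∀ φ ∈ C, |𝔼 x, (ν x - 1) * φ x| ≤ ε') →
      ∃ g : G → ℝ, (∀ x, 0 ≤ g x) ∧ (∀ x, g x ≤ 1) ∧ ∀ φ ∈ C, 𝔼 x, (f x - g x) * φ x ≤ ε := by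
  obtain ⟨p, hp⟩ := exists_polynomial_near_of_continuousOn (-1) 1 (fun t => max t 0)
    (by fun_prop) (ε / 10) (by positivity)
  set A : ℝ := ∑ n ∈ p.support, |p.coeff n| with hA
  have hA0 : 0 ≤ A := sum_nonneg fun _ _ => abs_nonneg _
  refine ⟨min 1 (ε / (4 * (A + 1))), by positivity, ?_⟩
  intro G _ _ C hC hconv h1 hb hmul ν f hf0 hfν hν
  set ε' := min 1 (ε / (4 * (A + 1))) with hε'
  have hε'1 : ε' ≤ 1 := min_le_left _ _
  have hAε' : A * ε' ≤ ε / 4 := by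
    have h2 : ε' ≤ ε / (4 * (A + 1)) := min_le_right _ _
    rw [le_div_iff₀ (by positivity)] at h2
    have : 0 ≤ ε' := by positivity
    nlinarith
  clear_value ε'
  have hlin : ∀ φ : G → ℝ, ∀ u v : G → ℝ, ∀ a b : ℝ, a + b = 1 →
      𝔼 x, (f x - (a • u + b • v) x) * φ x =
        a • (𝔼 x, (f x - u x) * φ x) + b • 𝔼 x, (f x - v x) * φ x := by
    intro φ u v a b hab
    simp only [smul_eq_mul, mul_expect, Pi.add_apply, Pi.smul_apply]
    rw [← expect_add_distrib]
    refine expect_congr rfl fun x _ => ?_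
    linear_combination (-(f x * φ x)) * hab
  have hlin' : ∀ g : G → ℝ, ∀ u v : G → ℝ, ∀ a b : ℝ,
      𝔼 x, (f x - g x) * (a • u + b • v) x =
        a • (𝔼 x, (f x - g x) * u x) + b • 𝔼 x, (f x - g x) * v x := by
    intro g u v a b
    simp only [smul_eq_mul, mul_expect, Pi.add_apply, Pi.smul_apply]
    rw [← expect_add_distrib]
    exact expect_congr rfl fun x _ => by ring
  obtain ⟨g, hg, φ, hφ, hsad⟩ := Sion.exists_isSaddlePointOn (X := Set.Icc (0 : G → ℝ) 1) (Y := C)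
    (f := fun g φ => 𝔼 x, (f x - g x) * φ x) ⟨0, by simp⟩ (convex_Icc _ _) isCompact_Icc
    (fun φ _ => (continuous_expect fun x => by fun_prop).continuousOn.lowerSemicontinuousOn)
    (fun φ _ => ConvexOn.quasiconvexOn ⟨convex_Icc _ _, fun u _ v _ a b _ _ hab =>
      (hlin φ u v a b hab).le⟩)
    hconv ⟨1, h1⟩ hC
    (fun g _ => (continuous_expect fun x => by fun_prop).continuousOn.upperSemicontinuousOn)
    (fun g _ => ConcaveOn.quasiconcaveOn ⟨hconv, fun u _ v _ a b _ _ _ =>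
      (hlin' g u v a b).ge⟩)
  refine ⟨g, fun x => hg.1 x, fun x => hg.2 x, fun χ hχ => ?_⟩
  have h2 := hsad (fun x => if 0 < φ x then 1 else 0)
    ⟨fun x => by dsimp only; split_ifs <;> simp, fun x => by dsimp only; split_ifs <;> simp⟩ χ hχ
  refine h2.trans ?_
  have hpow : ∀ n : ℕ, φ ^ n ∈ C := by
    intro n
    induction n with
    | zero => simpa using h1
    | succ n ih => rw [pow_succ]; exact hmul _ ih _ hφ
  have hmem : ∀ x, φ x ∈ Set.Icc (-1 : ℝ) 1 := fun x => abs_le.1 (hb φ hφ x)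
  have h3 : 𝔼 x, (ν x - 1) * p.eval (φ x) ≤ ε / 4 := by
    have e : 𝔼 x, (ν x - 1) * p.eval (φ x) =
        ∑ n ∈ p.support, p.coeff n * 𝔼 x, (ν x - 1) * (φ ^ n) x := by
      simp_rw [mul_expect]
      rw [← expect_sum_comm]
      refine expect_congr rfl fun x _ => ?_
      rw [Polynomial.eval_eq_sum, Polynomial.sum, mul_sum]
      exact sum_congr rfl fun n _ => by simp only [Pi.pow_apply]; ring
    rw [e]
    calc _ ≤ ∑ n ∈ p.support, |p.coeff n| * ε' := sum_le_sum fun n _ => by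
          refine (le_abs_self _).trans ?_
          rw [abs_mul]
          exact mul_le_mul_of_nonneg_left (hν _ (hpow n)) (abs_nonneg _)
      _ = A * ε' := by rw [← sum_mul]
      _ ≤ _ := hAε'
  have h4 : 𝔼 x, (ν x - 1) ≤ 1 := by
    have := (le_abs_self _).trans (hν 1 h1)
    simp only [Pi.one_apply, mul_one] at this
    exact this.trans hε'1
  have h5 : 𝔼 x, (f x - (if 0 < φ x then 1 else 0)) * φ x ≤
      𝔼 x, ((ν x - 1) * p.eval (φ x) + (ε / 10 * (ν x - 1) + ε / 5)) := by
    refine expect_le_expect fun x _ => ?_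
    have h6 := abs_lt.1 (hp (φ x) (hmem x))
    have h7 : f x * φ x ≤ ν x * max (φ x) 0 :=
      (mul_le_mul_of_nonneg_left (le_max_left _ _) (hf0 x)).trans
        (mul_le_mul_of_nonneg_right (hfν x) (le_max_right _ _))
    have h8 : (if 0 < φ x then (1 : ℝ) else 0) * φ x = max (φ x) 0 := by
      split_ifs with h
      · rw [one_mul, max_eq_left h.le]
      · rw [zero_mul, max_eq_right (not_lt.1 h)]
    have hν0 : 0 ≤ ν x := (hf0 x).trans (hfν x)
    rw [sub_mul, h8]
    nlinarith [mul_nonneg hν0 (sub_nonneg.2 h6.1.le)]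
  refine h5.trans ?_
  rw [expect_add_distrib, expect_add_distrib, ← mul_expect, Fintype.expect_const]
  nlinarith

/-- **Dense model theorem.** -/
theorem exists_dense_model (ε : ℝ) (hε : 0 < ε) : ∃ ε' : ℝ, 0 < ε' ∧
    ∀ (G : Type) [Fintype G] [Nonempty G] (C : Set (G → ℝ)), Convex ℝ C →
      (1 : G → ℝ) ∈ C → (∀ φ ∈ C, ∀ x, |φ x| ≤ 1) → (∀ φ ∈ C, ∀ ψ ∈ C, φ * ψ ∈ C) →
      ∀ ν f : G → ℝ, (∀ x, 0 ≤ f x) → (∀ x, f x ≤ ν x) →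
      (∀ φ ∈ C, |𝔼 x, (ν x - 1) * φ x| ≤ ε') →
      ∃ g : G → ℝ, (∀ x, 0 ≤ g x) ∧ (∀ x, g x ≤ 1) ∧ ∀ φ ∈ C, 𝔼 x, (f x - g x) * φ x ≤ ε := by
  obtain ⟨ε', hε', H⟩ := exists_dense_model_of_isCompact ε hε
  refine ⟨ε', hε', ?_⟩
  intro G _ _ C hconv h1 hb hmul ν f hf0 hfν hν
  have hb' : closure C ⊆ Set.Icc (-1 : G → ℝ) 1 := closure_minimal
    (fun φ hφ => ⟨fun x => (abs_le.1 (hb φ hφ x)).1, fun x => (abs_le.1 (hb φ hφ x)).2⟩) isClosed_Icc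
  obtain ⟨g, hg0, hg1, hg⟩ := H G (closure C)
    (isCompact_Icc.of_isClosed_subset isClosed_closure hb') hconv.closure (subset_closure h1)
    (fun φ hφ x => abs_le.2 ⟨(hb' hφ).1 x, (hb' hφ).2 x⟩)
    (fun φ hφ ψ hψ => map_mem_closure₂ continuous_mul hφ hψ hmul) ν f hf0 hfν
    (by
      have hcl : IsClosed {φ : G → ℝ | |𝔼 x, (ν x - 1) * φ x| ≤ ε'} :=
        isClosed_le (continuous_expect fun x => by fun_prop).abs continuous_const
      exact fun φ hφ => closure_minimal hν hcl hφ)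
  exact ⟨g, hg0, hg1, fun φ hφ => hg φ (subset_closure hφ)⟩

section DenseModel

variable {I : Type} [Fintype I] [DecidableEq I] {G : Type} [Fintype G]

/-- Products of bounded functions of fewer variables, with no factor in position `o`. -/
def TestFn (o : I) (U : (I → G) → ℝ) : Prop :=
  ∃ u : I → (I → G) → ℝ, (∀ l, Indep l (u l)) ∧ (∀ l x, |u l x| ≤ 1) ∧
    ∀ x, U x = ∏ l ∈ univ.erase o, u l x

lemma TestFn.abs_le {o : I} {U : (I → G) → ℝ} (h : TestFn o U) (x : I → G) : |U x| ≤ 1 := by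
  obtain ⟨u, _, hu, hU⟩ := h
  rw [hU, abs_prod]
  exact prod_le_one (fun _ _ => abs_nonneg _) fun l _ => hu l x

lemma TestFn.one (o : I) : TestFn o (1 : (I → G) → ℝ) :=
  ⟨fun _ => 1, fun _ _ _ => rfl, by simp, by simp⟩

lemma TestFn.mul {o : I} {U V : (I → G) → ℝ} (hU : TestFn o U) (hV : TestFn o V) :
    TestFn o (U * V) := by
  obtain ⟨u, hui, hu, hU⟩ := hU
  obtain ⟨v, hvi, hv, hV⟩ := hV
  refine ⟨fun l => u l * v l, fun l x a => ?_, fun l x => ?_, fun x => ?_⟩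
  · simp only [Pi.mul_apply, hui l x a, hvi l x a]
  · change |u l x * v l x| ≤ 1
    rw [abs_mul]
    exact mul_le_one₀ (hu l x) (abs_nonneg _) (hv l x)
  · simp only [Pi.mul_apply, hU, hV, prod_mul_distrib]

lemma TestFn.neg {o l₁ : I} (h : l₁ ≠ o) {U : (I → G) → ℝ} (hU : TestFn o U) :
    TestFn o (-U) := by
  obtain ⟨u, hui, hu, hU⟩ := hU
  refine ⟨fun l x => (if l = l₁ then -1 else 1) * u l x, fun l x a => ?_, fun l x => ?_,
    fun x => ?_⟩
  · simp only [hui l x a]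
  · rw [abs_mul]
    split_ifs <;> simpa using hu l x
  · rw [prod_mul_distrib, ← hU, prod_ite_eq']
    simp [h]

variable [AddCommGroup G]

lemma TestFn.translate {o : I} {U : (I → G) → ℝ} (hU : TestFn o U) (v : I → G) :
    TestFn o fun x => U (x + v) := by
  obtain ⟨u, hui, hu, hU⟩ := hU
  refine ⟨fun l x => u l (x + v), fun l x a => ?_, fun l x => hu l _, fun x => hU _⟩
  have : Function.update x l a + v = Function.update (x + v) l (a + v l) := by
    rw [Function.update_add, Function.update_eq_self]
  simp only [this, hui l _ _]

/-- The sum of all coordinates except `o`. -/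
def sumErase (o : I) (x : I → G) : G := ∑ l ∈ univ.erase o, x l

lemma sumErase_add (o : I) (x y : I → G) : sumErase o (x + y) = sumErase o x + sumErase o y :=
  sum_add_distrib

lemma sumErase_single {o l₁ : I} (h : l₁ ≠ o) (s : G) : sumErase o (Pi.single l₁ s) = s := by
  unfold sumErase
  rw [sum_eq_single_of_mem l₁ (by simp [h])]
  · simp
  · intro b _ hb
    simp [hb]

/-- The average of `U` over the fibre of `sumErase o` above `t`. -/
def fibreAvg (o l₁ : I) (U : (I → G) → ℝ) (t : G) : ℝ :=
  𝔼 x, U (x + Pi.single l₁ (t - sumErase o x))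

lemma expect_mul_fibreAvg {o l₁ : I} (h : l₁ ≠ o) (U : (I → G) → ℝ) (w : G → ℝ) :
    𝔼 t, w t * fibreAvg o l₁ U t = 𝔼 x, w (sumErase o x) * U x := by
  unfold fibreAvg
  simp_rw [mul_expect]
  rw [expect_comm]
  have h1 : ∀ x : I → G, 𝔼 t, w t * U (x + Pi.single l₁ (t - sumErase o x)) =
      𝔼 s, w (sumErase o (x + Pi.single l₁ s)) * U (x + Pi.single l₁ s) := by
    intro x
    refine Fintype.expect_equiv (Equiv.subRight (sumErase o x)) _ _ fun t => ?_
    rw [sumErase_add, sumErase_single h]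
    simp
  simp_rw [h1]
  rw [expect_comm]
  have h2 : ∀ s : G, 𝔼 x, w (sumErase o (x + Pi.single l₁ s)) * U (x + Pi.single l₁ s) =
      𝔼 x, w (sumErase o x) * U x := fun s =>
    Fintype.expect_equiv (Equiv.addRight (Pi.single l₁ s)) _ _ fun x => rfl
  simp_rw [h2]
  rw [Fintype.expect_const]

lemma fibreAvg_mul (o l₁ : I) (U V : (I → G) → ℝ) (t : G) :
    fibreAvg o l₁ U t * fibreAvg o l₁ V t =
      𝔼 w : I → G,
        fibreAvg o l₁ (U * fun x => V (x + (w - (Pi.single l₁ (sumErase o w) : I → G)))) t := by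
  unfold fibreAvg
  rw [Fintype.expect_mul_expect]
  have h1 : ∀ x : I → G, 𝔼 y, U (x + Pi.single l₁ (t - sumErase o x)) *
      V (y + Pi.single l₁ (t - sumErase o y)) =
      𝔼 w, U (x + Pi.single l₁ (t - sumErase o x)) *
        V (x + w + Pi.single l₁ (t - sumErase o (x + w))) := fun x =>
    Fintype.expect_equiv (Equiv.subRight x) _ _ fun y => by simp
  simp_rw [h1]
  rw [expect_comm]
  refine expect_congr rfl fun w _ => expect_congr rfl fun x _ => ?_
  simp only [Pi.mul_apply]
  congr 2
  rw [sumErase_add, ← sub_sub, Pi.single_sub]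
  abel

lemma fibreAvg_abs_le {o l₁ : I} {U : (I → G) → ℝ} (hU : TestFn o U) (t : G) :
    |fibreAvg o l₁ U t| ≤ 1 :=
  (abs_expect_le _ _).trans (expect_le univ_nonempty fun _ _ => hU.abs_le _)

lemma mul_mem_convexHull_fibreAvg {o l₁ : I} {φ χ : G → ℝ}
    (hφ : φ ∈ convexHull ℝ (fibreAvg o l₁ '' {U : (I → G) → ℝ | TestFn o U}))
    (hχ : χ ∈ convexHull ℝ (fibreAvg o l₁ '' {U : (I → G) → ℝ | TestFn o U})) :
    φ * χ ∈ convexHull ℝ (fibreAvg o l₁ '' {U : (I → G) → ℝ | TestFn o U}) := by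
  set D := fibreAvg o l₁ '' {U : (I → G) → ℝ | TestFn o U} with hD
  have hc := convex_convexHull ℝ D
  have h0 : ∀ φ ∈ D, ∀ χ ∈ D, φ * χ ∈ convexHull ℝ D := by
    rintro _ ⟨U, hU, rfl⟩ _ ⟨V, hV, rfl⟩
    have e : fibreAvg o l₁ U * fibreAvg o l₁ V = ∑ w : I → G, (Fintype.card (I → G) : ℝ)⁻¹ •
        fibreAvg o l₁ (U * fun x => V (x + (w - (Pi.single l₁ (sumErase o w) : I → G)))) := by
      ext t
      rw [Pi.mul_apply, fibreAvg_mul, Fintype.expect_eq_sum_div_card]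
      simp only [Finset.sum_apply, Pi.smul_apply, smul_eq_mul]
      rw [← mul_sum, div_eq_inv_mul]
    rw [e]
    refine hc.sum_mem (fun _ _ => by positivity) ?_ fun w _ => subset_convexHull _ _
      ⟨_, TestFn.mul hU (hV.translate _), rfl⟩
    simp
  have h1 : ∀ χ ∈ D, ∀ φ ∈ convexHull ℝ D, φ * χ ∈ convexHull ℝ D := by
    intro χ hχ φ hφ
    refine (convexHull_min (fun φ hφ => h0 φ hφ χ hχ) ?_ :
      convexHull ℝ D ⊆ {φ | φ * χ ∈ convexHull ℝ D}) hφ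
    intro u hu v hv a b ha hb hab
    simp only [Set.mem_ofPred_eq, add_mul, smul_mul_assoc] at hu hv ⊢
    exact hc hu hv ha hb hab
  refine (convexHull_min (fun χ hχ => h1 χ hχ φ hφ) ?_ :
    convexHull ℝ D ⊆ {χ | φ * χ ∈ convexHull ℝ D}) hχ
  intro u hu v hv a b ha hb hab
  simp only [Set.mem_ofPred_eq, mul_add, mul_smul_comm] at hu hv ⊢
  exact hc hu hv ha hb hab

end DenseModel

/-- Dense model theorem with respect to products of functions of fewer variables. -/
theorem exists_dense_model_testFn (I : Type) [Fintype I] [DecidableEq I] {o l₁ : I} (h : l₁ ≠ o)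
    (ε : ℝ) (hε : 0 < ε) : ∃ ε' : ℝ, 0 < ε' ∧
    ∀ (G : Type) [Fintype G] [AddCommGroup G] (ν f : G → ℝ), (∀ x, 0 ≤ f x) → (∀ x, f x ≤ ν x) →
      (∀ U : (I → G) → ℝ, TestFn o U → |𝔼 x, (ν (sumErase o x) - 1) * U x| ≤ ε') →
      ∃ g : G → ℝ, (∀ x, 0 ≤ g x) ∧ (∀ x, g x ≤ 1) ∧
        ∀ U : (I → G) → ℝ, TestFn o U →
          |𝔼 x, (f (sumErase o x) - g (sumErase o x)) * U x| ≤ ε := by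
  obtain ⟨ε', hε', H⟩ := exists_dense_model ε hε
  refine ⟨ε', hε', ?_⟩
  intro G _ _ ν f hf0 hfν hν
  have hlin : ∀ (w : G → ℝ) (u v : G → ℝ) (a b : ℝ), 𝔼 x, w x * (a • u + b • v) x =
      a * (𝔼 x, w x * u x) + b * 𝔼 x, w x * v x := by
    intro w u v a b
    simp only [mul_expect, Pi.add_apply, Pi.smul_apply, smul_eq_mul]
    rw [← expect_add_distrib]
    exact expect_congr rfl fun x _ => by ring
  obtain ⟨g, hg0, hg1, hg⟩ := H G
    (convexHull ℝ (fibreAvg o l₁ '' {U : (I → G) → ℝ | TestFn o U})) (convex_convexHull _ _)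
    (subset_convexHull _ _ ⟨1, TestFn.one o, by ext t; simp [fibreAvg]⟩)
    (fun φ hφ x => by
      have hb : Convex ℝ (Set.Icc (-1 : G → ℝ) 1) := convex_Icc _ _
      have : φ ∈ Set.Icc (-1 : G → ℝ) 1 := convexHull_min (by
        rintro _ ⟨U, hU, rfl⟩
        exact ⟨fun x => (_root_.abs_le.1 (fibreAvg_abs_le hU x)).1,
          fun x => (_root_.abs_le.1 (fibreAvg_abs_le hU x)).2⟩) hb hφ
      exact _root_.abs_le.2 ⟨this.1 x, this.2 x⟩)
    (fun φ hφ χ hχ => mul_mem_convexHull_fibreAvg hφ hχ) ν f hf0 hfν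
    (fun φ hφ => by
      refine (convexHull_min ?_ ?_ : convexHull ℝ _ ⊆
        {φ : G → ℝ | |𝔼 x, (ν x - 1) * φ x| ≤ ε'}) hφ
      · rintro _ ⟨U, hU, rfl⟩
        rw [Set.mem_ofPred_eq, expect_mul_fibreAvg h U fun x => ν x - 1]
        exact hν U hU
      · intro u hu v hv a b ha hb hab
        simp only [Set.mem_ofPred_eq] at hu hv ⊢
        rw [hlin]
        refine (abs_add_le _ _).trans ?_
        rw [abs_mul, abs_mul, abs_of_nonneg ha, abs_of_nonneg hb]
        calc _ ≤ a * ε' + b * ε' := by gcongr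
          _ = ε' := by rw [← add_mul, hab, one_mul])
  have hone : ∀ U : (I → G) → ℝ, TestFn o U →
      𝔼 x, (f (sumErase o x) - g (sumErase o x)) * U x ≤ ε := by
    intro U hU
    rw [← expect_mul_fibreAvg h U fun x => f x - g x]
    exact hg _ (subset_convexHull _ _ ⟨U, hU, rfl⟩)
  refine ⟨g, hg0, hg1, fun U hU => _root_.abs_le.2 ⟨?_, hone U hU⟩⟩
  have := hone _ (hU.neg h)
  simp only [Pi.neg_apply, mul_neg, expect_neg_distrib] at this
  linarith

section LinearForm

variable {I : Type} [Fintype I] [DecidableEq I] {K : Type} [Field K]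

/-- Permuting the coordinates and rescaling them by non-zero factors. -/
def scaleEquiv (σ : Equiv.Perm I) (c : I → K) (hc : ∀ i, c i ≠ 0) : (I → K) ≃ (I → K) where
  toFun x i := c (σ i) * x (σ i)
  invFun y i := (c i)⁻¹ * y (σ.symm i)
  left_inv x := by
    ext i
    simp [hc]
  right_inv y := by
    ext i
    simp [hc]

lemma scaleEquiv_apply (σ : Equiv.Perm I) (c : I → K) (hc : ∀ i, c i ≠ 0) (x : I → K) (i : I) :
    scaleEquiv σ c hc x i = c (σ i) * x (σ i) := rfl

lemma scaleEquiv_symm_apply (σ : Equiv.Perm I) (c : I → K) (hc : ∀ i, c i ≠ 0) (y : I → K)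
    (i : I) : (scaleEquiv σ c hc).symm y i = (c i)⁻¹ * y (σ.symm i) := rfl

lemma prod_erase_perm (σ : Equiv.Perm I) (o : I) (v : I → ℝ) :
    ∏ i ∈ univ.erase (σ o), v i = ∏ i ∈ univ.erase o, v (σ i) := by
  symm
  refine prod_equiv σ (fun i => ?_) fun _ _ => rfl
  simp

lemma sumErase_scaleEquiv (σ : Equiv.Perm I) (c : I → K) (hc : ∀ i, c i ≠ 0) {a : I → K} {o : I}
    (h0 : a (σ o) = 0) (ha : ∀ i, i ≠ σ o → c i = a i) (x : I → K) :
    sumErase o (scaleEquiv σ c hc x) = ∑ i, a i * x i := by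
  unfold sumErase
  rw [← add_sum_erase univ (fun i => a i * x i) (mem_univ (σ o)), h0, zero_mul, zero_add]
  refine sum_equiv σ (fun i => by simp) fun i hi => ?_
  rw [scaleEquiv_apply, ha]
  simpa using hi

variable [Fintype K]

/-- Averages of products along a linear form omitting only the variable `j` can be computed along
the sum of all variables except `o`. -/
lemma exists_testFn_expect_eq {a : I → K} {j : I} (hj : a j = 0) (ha : ∀ i, i ≠ j → a i ≠ 0)
    (o : I) {u : I → (I → K) → ℝ} (hui : ∀ i, Indep i (u i)) (hu : ∀ i x, |u i x| ≤ 1) :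
    ∃ U : (I → K) → ℝ, TestFn o U ∧ ∀ w : K → ℝ,
      𝔼 x : I → K, w (∑ i, a i * x i) * ∏ i ∈ univ.erase j, u i x =
        𝔼 x : I → K, w (sumErase o x) * U x := by
  set σ := Equiv.swap o j
  have hσ : σ o = j := Equiv.swap_apply_left _ _
  set c : I → K := fun i => if i = j then 1 else a i
  have hc : ∀ i, c i ≠ 0 := by
    intro i
    by_cases h : i = j
    · simp [c, h]
    · simpa [c, h] using ha i h
  set e := scaleEquiv σ c hc with he
  have hs : ∀ x, sumErase o (e x) = ∑ i, a i * x i := sumErase_scaleEquiv σ c hc (hσ ▸ hj)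
    (fun i hi => by rw [hσ] at hi; simp [c, hi])
  refine ⟨fun y => ∏ l ∈ univ.erase o, u (σ l) (e.symm y),
    ⟨fun l y => u (σ l) (e.symm y), fun l y b => ?_, fun l y => hu _ _, fun _ => rfl⟩,
    fun w => ?_⟩
  · have : e.symm (Function.update y l b) =
        Function.update (e.symm y) (σ l) ((c (σ l))⁻¹ * b) := by
      ext i
      rw [he, scaleEquiv_symm_apply]
      by_cases hi : i = σ l
      · subst hi
        simp
      · have : σ.symm i ≠ l := fun h => hi (by rw [← h, Equiv.apply_symm_apply])
        rw [Function.update_of_ne this, Function.update_of_ne hi, scaleEquiv_symm_apply]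
    simp only [this]
    exact hui _ _ _
  · refine Fintype.expect_equiv e _ _ fun x => ?_
    simp only [hs, Equiv.symm_apply_apply]
    rw [← hσ, prod_erase_perm σ o fun i => u i x]

lemma exists_indep_expect_eq {a : I → K} {o : I} (ho : a o = 0) (ha : ∀ i, i ≠ o → a i ≠ 0)
    {U : (I → K) → ℝ} (hU : TestFn o U) :
    ∃ u : I → (I → K) → ℝ, (∀ i, Indep i (u i)) ∧ (∀ i x, |u i x| ≤ 1) ∧ ∀ w : K → ℝ,
      𝔼 x : I → K, w (sumErase o x) * U x =
        𝔼 x : I → K, w (∑ i, a i * x i) * ∏ i ∈ univ.erase o, u i x := by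
  obtain ⟨u, hui, hu, hU⟩ := hU
  set c : I → K := fun i => if i = o then 1 else a i
  have hc : ∀ i, c i ≠ 0 := by
    intro i
    by_cases h : i = o
    · simp [c, h]
    · simpa [c, h] using ha i h
  set e := scaleEquiv 1 c hc with he
  have hs : ∀ x, sumErase o (e x) = ∑ i, a i * x i := sumErase_scaleEquiv 1 c hc ho
    (fun i hi => by
      have : i ≠ o := hi
      simp [c, this])
  refine ⟨fun l x => u l (e x), fun l x b => ?_, fun l x => hu _ _, fun w => ?_⟩
  · have : e (Function.update x l b) = Function.update (e x) l (c l * b) := by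
      ext i
      rw [he, scaleEquiv_apply, Equiv.Perm.one_apply]
      by_cases hi : i = l
      · subst hi
        simp
      · rw [Function.update_of_ne hi, Function.update_of_ne hi, scaleEquiv_apply,
          Equiv.Perm.one_apply]
    simp only [this]
    exact hui _ _ _
  · symm
    refine Fintype.expect_equiv e _ _ fun x => ?_
    simp only [hs, hU]

end LinearForm

/-- The linear forms whose values at `x` are the points of the progression with step `-∑ i, x i`
starting at `∑ i, i * x i`; the `j`-th one does not involve the variable `j`. -/
def apForm {k : ℕ} {R : Type} [CommRing R] (j : Fin k) (x : Fin k → R) : R :=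
  ∑ i : Fin k, (((i : ℕ) : R) - ((j : ℕ) : R)) * x i

lemma apForm_indep {k : ℕ} {R : Type} [CommRing R] (w : R → ℝ) (j : Fin k) :
    Indep j fun x : Fin k → R => w (apForm j x) := by
  intro x a
  refine congrArg w ?_
  unfold apForm
  refine sum_congr rfl fun i _ => ?_
  by_cases h : i = j
  · subst h
    simp
  · rw [Function.update_of_ne h]

lemma natCast_sub_ne_zero {k M : ℕ} (hM : k ≤ M) {i j : Fin k} (h : i ≠ j) :
    ((i : ℕ) : ZMod M) - ((j : ℕ) : ZMod M) ≠ 0 := by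
  rw [sub_ne_zero, Ne, ZMod.natCast_eq_natCast_iff', Nat.mod_eq_of_lt (i.2.trans_le hM),
    Nat.mod_eq_of_lt (j.2.trans_le hM)]
  exact fun e => h (Fin.ext e)

lemma expect_comp_sumErase {I : Type} [Fintype I] [DecidableEq I] {G : Type} [Fintype G]
    [AddCommGroup G] {o l₁ : I} (h : l₁ ≠ o) (w : G → ℝ) :
    𝔼 x : I → G, w (sumErase o x) = 𝔼 t, w t := by
  have := expect_mul_fibreAvg h 1 w
  simpa [fibreAvg] using this.symm

/-- Functions dominated by a pseudorandom weight have dense models with almost the same number of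
progressions. -/
theorem exists_dense_model_apForm {k : ℕ} (hk : 2 ≤ k) {γ : ℝ} (hγ : 0 < γ) :
    ∃ η : ℝ, 0 < η ∧ ∀ (M : ℕ) [Fact M.Prime], k ≤ M → ∀ ν f : ZMod M → ℝ, (∀ x, 0 ≤ f x) →
      (∀ x, f x ≤ ν x) → LFC (fun (j : Fin k) x => ν (apForm j x)) η →
      ∃ g : ZMod M → ℝ, (∀ x, 0 ≤ g x) ∧ (∀ x, g x ≤ 1) ∧ |𝔼 x, f x - 𝔼 x, g x| ≤ γ ∧
        |𝔼 x : Fin k → ZMod M, ∏ j, f (apForm j x) -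
          𝔼 x : Fin k → ZMod M, ∏ j, g (apForm j x)| ≤ γ := by
  set o : Fin k := ⟨0, by omega⟩ with ho
  set l₁ : Fin k := ⟨1, by omega⟩ with hl₁
  have hne : l₁ ≠ o := by simp [ho, hl₁]
  obtain ⟨η₁, hη₁, H₁⟩ := exists_counting (univ : Finset (Fin k)) γ hγ
  obtain ⟨ε', hε', H₂⟩ := exists_dense_model_testFn (Fin k) hne (min η₁ γ) (lt_min hη₁ hγ)
  obtain ⟨η₂, hη₂, H₃⟩ := exists_doubled_correlation_small o ε' hε'
  refine ⟨min η₁ η₂, lt_min hη₁ hη₂, ?_⟩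
  intro M _ hkM ν f hf0 hfν hLFC
  have ha : ∀ i j : Fin k, i ≠ j → ((i : ℕ) : ZMod M) - ((j : ℕ) : ZMod M) ≠ 0 :=
    fun i j h => natCast_sub_ne_zero hkM h
  obtain ⟨g, hg0, hg1, hg⟩ := H₂ (ZMod M) ν f hf0 hfν (by
    intro U hU
    obtain ⟨u, hui, hu, e⟩ := exists_indep_expect_eq (a := fun i : Fin k =>
      ((i : ℕ) : ZMod M) - ((o : ℕ) : ZMod M)) (sub_self _) (fun i hi => ha i o hi) hU
    rw [e fun t => ν t - 1]
    have := H₃ (ZMod M) (fun j x => ν (apForm j x)) (fun _ _ => (hf0 _).trans (hfν _))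
      (fun l => apForm_indep ν l) (hLFC.mono (min_le_right _ _)) u 1
      (fun l x => (hu l x).trans (le_add_of_nonneg_left ((hf0 _).trans (hfν _))))
      (fun l x => by
        simpa using (hf0 _).trans (hfν _))
      (fun l _ => hui l) (fun l _ _ _ => rfl)
    simpa [apForm] using this)
  refine ⟨g, hg0, hg1, ?_, ?_⟩
  · have := hg 1 (TestFn.one o)
    simp only [Pi.one_apply, mul_one] at this
    rw [expect_sub_distrib, expect_comp_sumErase hne, expect_comp_sumErase hne] at this
    exact this.trans (min_le_right _ _)
  · have := H₁ (ZMod M) (fun j x => ν (apForm j x)) (fun j x => f (apForm j x))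
      (fun j x => g (apForm j x)) (fun l => apForm_indep ν l) (hLFC.mono (min_le_left _ _))
      (fun l => apForm_indep f l) (fun l => apForm_indep g l) (fun _ _ => hf0 _)
      (fun _ _ => hfν _) (fun _ _ => hg0 _) (fun _ _ => hg1 _) (by
        intro j u hui hu
        obtain ⟨U, hU, e⟩ := exists_testFn_expect_eq (a := fun i : Fin k =>
          ((i : ℕ) : ZMod M) - ((j : ℕ) : ZMod M)) (sub_self _) (fun i hi => ha i j hi) o hui hu
        refine le_trans (le_of_eq ?_) ((hg U hU).trans (min_le_left _ _))
        exact congrArg _ (e fun t => f t - g t)) 1 (fun _ _ _ => rfl) (by simp) (by simp)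
    simpa using this

lemma expect_comp_addMonoidHom {A B : Type} [Fintype A] [Fintype B] [AddCommGroup A]
    [AddCommGroup B] (T : A →+ B) (hT : Function.Surjective T) (F : B → ℝ) :
    𝔼 x, F (T x) = 𝔼 y, F y := by
  have h1 : ∀ y, 𝔼 x, F (T x) = 𝔼 x, F (T x + y) := by
    intro y
    obtain ⟨z, rfl⟩ := hT y
    symm
    exact Fintype.expect_equiv (Equiv.addRight z) _ _ fun x => by simp
  have h2 : ∀ x : A, 𝔼 y, F (T x + y) = 𝔼 y, F y := fun x =>
    Fintype.expect_equiv (Equiv.addLeft (T x)) _ _ fun y => rfl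
  calc 𝔼 x, F (T x) = 𝔼 y, 𝔼 x, F (T x + y) := by
        rw [← Fintype.expect_const (ι := B) (𝔼 x, F (T x))]
        exact expect_congr rfl fun y _ => h1 y
    _ = 𝔼 y, F y := by
        rw [expect_comm]
        simp_rw [h2]
        rw [Fintype.expect_const]

/-- The pair `(∑ i, i * x i, ∑ i, x i)`. -/
def momentHom (k : ℕ) (R : Type) [CommRing R] : (Fin k → R) →+ R × R where
  toFun x := (∑ i : Fin k, ((i : ℕ) : R) * x i, ∑ i, x i)
  map_zero' := by simp
  map_add' x y := by simp [mul_add, sum_add_distrib]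

lemma momentHom_surjective {k : ℕ} (hk : 2 ≤ k) (R : Type) [CommRing R] :
    Function.Surjective (momentHom k R) := by
  obtain ⟨n, rfl⟩ := Nat.exists_eq_add_of_le' hk
  rintro ⟨a, b⟩
  refine ⟨Fin.cons (b - a) (Fin.cons a 0), ?_⟩
  simp [momentHom, Fin.sum_univ_succ]

lemma apForm_eq {k : ℕ} {R : Type} [CommRing R] (j : Fin k) (x : Fin k → R) :
    apForm j x = (momentHom k R x).1 - ((j : ℕ) : R) * (momentHom k R x).2 := by
  simp [apForm, momentHom, sub_mul, sum_sub_distrib, mul_sum]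

lemma apForm_piecewise {k : ℕ} {R : Type} [CommRing R] (j : Fin k) (ω : Finset (Fin k))
    (x y : Fin k → R) : apForm j (ω.piecewise y x) =
      apForm j x + ∑ i, (if i ∈ ω then ((i : ℕ) : R) - ((j : ℕ) : R) else 0) * (y i - x i) := by
  unfold apForm
  rw [← sum_add_distrib]
  refine sum_congr rfl fun i _ => ?_
  by_cases h : i ∈ ω
  · simp only [piecewise_eq_of_mem _ _ _ h, h, if_true]
    ring
  · simp only [piecewise_eq_of_notMem _ _ _ h, h, if_false]
    ring

lemma expect_prod_apForm {k : ℕ} (hk : 2 ≤ k) {M : ℕ} [Fact M.Prime] (f : ZMod M → ℝ) :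
    𝔼 x : Fin k → ZMod M, ∏ j, f (apForm j x) =
      𝔼 a : ZMod M, 𝔼 r : ZMod M, ∏ i ∈ range k, f (a + i * r) := by
  simp_rw [apForm_eq]
  rw [expect_comp_addMonoidHom (momentHom k (ZMod M)) (momentHom_surjective hk _)
    fun p => ∏ j : Fin k, f (p.1 - ((j : ℕ) : ZMod M) * p.2), ← univ_product_univ, expect_product]
  refine expect_congr rfl fun a _ => Fintype.expect_equiv (Equiv.neg _) _ _ fun r => ?_
  rw [prod_range]
  refine prod_congr rfl fun j _ => ?_
  simp [sub_eq_add_neg]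

/-- Casting identifies `Fin M` with `ZMod M`. -/
def finEquivZMod (M : ℕ) [NeZero M] : Fin M ≃ ZMod M where
  toFun x := ((x : ℕ) : ZMod M)
  invFun z := ⟨z.val, z.val_lt⟩
  left_inv x := by
    ext
    exact ZMod.val_cast_of_lt x.2
  right_inv z := by simp

lemma sum_fin_div_eq_expect {M : ℕ} [NeZero M] (t : ℕ) (F : (Fin t → ZMod M) → ℝ) :
    (∑ x : Fin t → Fin M, F fun j => ((x j : ℕ) : ZMod M)) / (M : ℝ) ^ t = 𝔼 z, F z := by
  rw [Fintype.expect_eq_sum_div_card]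
  congr 1
  · exact Fintype.sum_equiv ((Equiv.refl _).arrowCongr (finEquivZMod M)) _ _ fun x => rfl
  · simp

lemma avgZ_eq_expect {M : ℕ} [NeZero M] (g : ZMod M → ℝ) : avgZ M g = 𝔼 x, g x := by
  unfold avgZ
  rw [Fintype.expect_eq_sum_div_card, ZMod.card, sum_range]
  congr 1
  exact Fintype.sum_equiv (finEquivZMod M) _ _ fun x => rfl

lemma apAvg_eq_expect (k : ℕ) {M : ℕ} [NeZero M] (g : ZMod M → ℝ) :
    apAvg k M g = 𝔼 a : ZMod M, 𝔼 r : ZMod M, ∏ i ∈ range k, g (a + i * r) := by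
  have h : ∀ a : ZMod M, 𝔼 r : ZMod M, ∏ i ∈ range k, g (a + i * r) =
      avgZ M fun r : ZMod M => ∏ i ∈ range k, g (a + i * r) := fun a => (avgZ_eq_expect _).symm
  simp_rw [h]
  rw [← avgZ_eq_expect]
  unfold apAvg avgZ
  rw [← sum_div, div_div, sq]

lemma ratZMod_intCast (a : ℤ) (m : ℕ) : ratZMod (a : ℚ) m = (a : ZMod m) := by
  simp [ratZMod]

/-- The coefficients of the linear form attached to `(j, ω)`. -/
def slotCoeff {k : ℕ} (p : Fin k × Finset (Fin k)) : Fin (k + 2) → ℤ :=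
  Fin.cons 1 (Fin.cons (-((p.1 : ℕ) : ℤ))
    fun i => if i ∈ p.2 then ((i : ℕ) : ℤ) - ((p.1 : ℕ) : ℤ) else 0)

lemma natAbs_slotCoeff_le {k : ℕ} (p : Fin k × Finset (Fin k)) (i : Fin (k + 2)) :
    (slotCoeff p i).natAbs ≤ k := by
  have hp := p.1.2
  refine Fin.cases ?_ (fun i => Fin.cases ?_ (fun i => ?_) i) i
  · simp only [slotCoeff, Fin.cons_zero]
    omega
  · simp only [slotCoeff, Fin.cons_succ, Fin.cons_zero]
    omega
  · have hi := i.2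
    simp only [slotCoeff, Fin.cons_succ]
    split_ifs <;> omega

lemma eq_of_slotCoeff_proportional {k : ℕ} {p p' : Fin k × Finset (Fin k)} (hp : p.1 ∉ p.2)
    (hp' : p'.1 ∉ p'.2) {q : ℚ}
    (h : (fun i => (slotCoeff p i : ℚ)) = q • fun i => (slotCoeff p' i : ℚ)) : p = p' := by
  have h0 := congrFun h 0
  simp only [slotCoeff, Fin.cons_zero, Pi.smul_apply, smul_eq_mul, Int.cast_one, mul_one] at h0
  subst h0
  rw [one_smul] at h
  have h' : ∀ i, slotCoeff p i = slotCoeff p' i := fun i => by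
    exact_mod_cast congrFun h i
  have h1 : p.1 = p'.1 := by
    have := h' (Fin.succ 0)
    simp only [slotCoeff, Fin.cons_succ, Fin.cons_zero] at this
    ext
    omega
  refine Prod.ext h1 ?_
  ext i
  have h2 := h' i.succ.succ
  simp only [slotCoeff, Fin.cons_succ, h1] at h2
  by_cases hi : i = p'.1
  · subst hi
    rw [h1] at hp
    simp [hp, hp']
  · have hne : ((i : ℕ) : ℤ) - ((p'.1 : ℕ) : ℤ) ≠ 0 := by
      intro e
      exact hi (Fin.ext (by omega))
    by_cases h3 : i ∈ p.2 <;> by_cases h4 : i ∈ p'.2 <;> simp_all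

lemma card_slots_le {k : ℕ} (t : Finset (Fin k × Finset (Fin k))) (ht : ∀ p ∈ t, p.1 ∉ p.2) :
    t.card ≤ k * 2 ^ (k - 1) := by
  have hsub : t ⊆ univ.biUnion fun j : Fin k =>
      (univ.erase j).powerset.image fun ω => (j, ω) := by
    intro p hp
    simp only [mem_biUnion, mem_univ, true_and, mem_image, mem_powerset]
    exact ⟨p.1, p.2, subset_erase.2 ⟨subset_univ _, ht p hp⟩, rfl⟩
  refine (card_le_card hsub).trans (card_biUnion_le.trans ?_)
  calc ∑ j : Fin k, ((univ.erase j).powerset.image fun ω => (j, ω)).card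
      ≤ ∑ _j : Fin k, 2 ^ (k - 1) := by
        refine sum_le_sum fun j _ => card_image_le.trans ?_
        simp [card_powerset]
    _ = _ := by simp

/-- Splitting off the first two coordinates. -/
def splitHom (k : ℕ) (R : Type) [CommRing R] : (Fin (k + 2) → R) →+ (R × R) × (Fin k → R) where
  toFun z := ((z 0, z 1), fun i => z i.succ.succ)
  map_zero' := rfl
  map_add' _ _ := rfl

lemma splitHom_surjective (k : ℕ) (R : Type) [CommRing R] :
    Function.Surjective (splitHom k R) := by
  rintro ⟨⟨a, b⟩, h⟩
  exact ⟨Fin.cons a (Fin.cons b h), rfl⟩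

lemma expect_splitHom {k : ℕ} (hk : 2 ≤ k) {R : Type} [CommRing R] [Fintype R]
    (F : (R × R) × (Fin k → R) → ℝ) :
    𝔼 z, F (splitHom k R z) =
      𝔼 x : Fin k → R, 𝔼 y : Fin k → R, F (momentHom k R x, y - x) := by
  rw [expect_comp_addMonoidHom _ (splitHom_surjective k R), ← univ_product_univ, expect_product]
  have h1 : ∀ x : Fin k → R, 𝔼 y : Fin k → R, F (momentHom k R x, y - x) =
      𝔼 h : Fin k → R, F (momentHom k R x, h) := fun x =>
    Fintype.expect_equiv (Equiv.subRight x) _ _ fun y => rfl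
  simp_rw [h1]
  exact (expect_comp_addMonoidHom (momentHom k R) (momentHom_surjective hk R)
    fun p => 𝔼 h, F (p, h)).symm

/-- The value of the linear form attached to `(j, ω)`. -/
def slotForm {k : ℕ} {R : Type} [CommRing R] (p : Fin k × Finset (Fin k))
    (v : (R × R) × (Fin k → R)) : R :=
  v.1.1 - ((p.1 : ℕ) : R) * v.1.2 +
    ∑ i, (if i ∈ p.2 then ((i : ℕ) : R) - ((p.1 : ℕ) : R) else 0) * v.2 i

lemma sum_slotCoeff_mul {k : ℕ} {R : Type} [CommRing R] (p : Fin k × Finset (Fin k))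
    (z : Fin (k + 2) → R) :
    ∑ i, ((slotCoeff p i : ℤ) : R) * z i = slotForm p (splitHom k R z) := by
  rw [Fin.sum_univ_succ, Fin.sum_univ_succ]
  simp only [slotCoeff, Fin.cons_zero, Fin.cons_succ, slotForm, splitHom, AddMonoidHom.coe_mk,
    ZeroHom.coe_mk]
  push_cast
  rw [← add_assoc]
  congr 1
  rw [one_mul, neg_mul, ← sub_eq_add_neg]
  rfl

lemma apForm_piecewise_eq_slotForm {k : ℕ} {R : Type} [CommRing R]
    (p : Fin k × Finset (Fin k)) (x y : Fin k → R) :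
    apForm p.1 (p.2.piecewise y x) = slotForm p (momentHom k R x, y - x) := by
  rw [apForm_piecewise, apForm_eq]
  rfl

/-- The linear forms condition for `ν` yields the one for `ν` composed with the forms `apForm j`. -/
lemma exists_LFC_apForm {k : ℕ} (hk : 3 ≤ k) {M : ℕ → ℕ}
    (hMtop : Tendsto M atTop atTop) {ν : ∀ N, ZMod (M N) → ℝ}
    (hν : LinearFormsCondition M ν (k * 2 ^ (k - 1)) (3 * k - 4) k) {η : ℝ} (hη : 0 < η) :
    ∃ N₀ : ℕ, ∀ N ≥ N₀, ∀ _ : Fact (M N).Prime,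
      LFC (fun (j : Fin k) (x : Fin k → ZMod (M N)) => ν N (apForm j x)) η := by
  have key : ∀ t : Finset (Fin k × Finset (Fin k)), ∃ N₀ : ℕ, (∀ p ∈ t, p.1 ∉ p.2) →
      ∀ N ≥ N₀, ∀ _ : Fact (M N).Prime, |(𝔼 x : Fin k → ZMod (M N), 𝔼 y : Fin k → ZMod (M N),
        ∏ p ∈ t, ν N (apForm p.1 (p.2.piecewise y x))) - 1| ≤ η := by
    intro t
    by_cases ht : ∀ p ∈ t, p.1 ∉ p.2
    swap
    · exact ⟨0, fun h => absurd h ht⟩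
    set e := t.equivFin.symm
    obtain ⟨N₁, h₁⟩ := hν t.card (k + 2) (card_slots_le t ht) (by omega)
      (fun i j => (slotCoeff (e i : Fin k × Finset (Fin k)) j : ℚ))
      (fun i j => by
        refine ⟨?_, ?_⟩
        · rw [Rat.num_intCast]
          exact natAbs_slotCoeff_le _ _
        · rw [Rat.den_intCast]
          omega)
      (fun i h => by
        have := congrFun h 0
        simp [slotCoeff] at this)
      (fun i i' hii q h => hii (e.injective (Subtype.ext
        (eq_of_slotCoeff_proportional (ht _ (e i).2) (ht _ (e i').2) h)))) η hη
    obtain ⟨N₂, h₂⟩ := eventually_atTop.1 (hMtop.eventually_gt_atTop k)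
    refine ⟨max N₁ N₂, fun _ N hN _ => ?_⟩
    have h := h₁ N (le_of_max_le_left hN) (h₂ N (le_of_max_le_right hN)) 0
    rw [sum_fin_div_eq_expect (k + 2) fun z : Fin (k + 2) → ZMod (M N) =>
      ∏ i : Fin t.card, ν N (∑ j, ratZMod (slotCoeff (e i : Fin k × Finset (Fin k)) j : ℚ) (M N) *
        z j + (0 : Fin t.card → ZMod (M N)) i)] at h
    simp only [ratZMod_intCast, Pi.zero_apply, add_zero, sum_slotCoeff_mul] at h
    rw [expect_splitHom (by omega) fun v => ∏ i : Fin t.card,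
      ν N (slotForm (e i : Fin k × Finset (Fin k)) v)] at h
    simp only [← apForm_piecewise_eq_slotForm] at h
    refine le_of_eq_of_le (congrArg (fun s => |s - 1|) ?_) h
    refine expect_congr rfl fun x _ => expect_congr rfl fun y _ => ?_
    rw [← prod_coe_sort]
    exact (Equiv.prod_comp e fun p : t => ν N (apForm p.1.1 (p.1.2.piecewise y x))).symm
  choose N₀ hN₀ using key
  refine ⟨univ.sup N₀, fun N hN _ t ht => ?_⟩
  exact hN₀ t ht N ((le_sup (mem_univ t)).trans hN) inferInstance

end RelSz

/-- Green–Tao relative Szemerédi theorem: if `ν` is a `k`-pseudorandom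
measure and `0 ≤ f ≤ ν` with `E(f) ≥ δ`, then
`liminf E(f(x) f(x+r) ⋯ f(x+(k-1)r) | x, r ∈ Z_M) ≥ c(k,δ) > 0`. -/
theorem relative_szemeredi (k : ℕ) (hk : 3 ≤ k) (δ : ℝ) (hδ0 : 0 < δ) (hδ1 : δ ≤ 1) :
    ∃ c : ℝ, 0 < c ∧
      ∀ M : ℕ → ℕ, (∀ N, Nat.Prime (M N)) → Tendsto M atTop atTop →
        ∀ ν : (N : ℕ) → ZMod (M N) → ℝ, (∀ N n, 0 ≤ ν N n) →
          Pseudorandom k M ν →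
          ∀ f : (N : ℕ) → ZMod (M N) → ℝ,
            (∀ N (x : ZMod (M N)), 0 ≤ f N x) →
            (∀ N (x : ZMod (M N)), f N x ≤ ν N x) →
            (∀ N, δ ≤ avgZ (M N) (f N)) →
            ∀ γ : ℝ, 0 < γ → ∃ N₀ : ℕ, ∀ N ≥ N₀, c - γ ≤ apAvg k (M N) (f N) := by
  obtain ⟨n, rfl⟩ : ∃ n, k = n + 1 := ⟨k - 1, by omega⟩
  obtain ⟨c, hc, M₀, H⟩ := RelSz.szemeredi_varnavides n (half_pos hδ0)
  refine ⟨c, hc, ?_⟩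
  intro M hM hMtop ν _ hν f hf0 hfν hfδ γ hγ
  obtain ⟨η, hη, hdense⟩ := RelSz.exists_dense_model_apForm (k := n + 1) (by omega)
    (lt_min hγ (half_pos hδ0))
  obtain ⟨N₁, h₁⟩ := RelSz.exists_LFC_apForm hk hMtop hν.2.1 hη
  obtain ⟨N₂, h₂⟩ := eventually_atTop.1 (hMtop.eventually_ge_atTop (max (n + 1) M₀))
  refine ⟨max N₁ N₂, fun N hN => ?_⟩
  have hN₁ := le_of_max_le_left hN
  have hMN := h₂ N (le_of_max_le_right hN)
  have hp : Fact (M N).Prime := ⟨hM N⟩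
  obtain ⟨g, hg0, hg1, hfg, hap⟩ := hdense (M N) (le_of_max_le_left hMN) (ν N) (f N) (hf0 N)
    (hfν N) (h₁ N hN₁ hp)
  rw [RelSz.expect_prod_apForm (by omega), RelSz.expect_prod_apForm (by omega)] at hap
  have hδN := hfδ N
  rw [RelSz.avgZ_eq_expect] at hδN
  rw [RelSz.apAvg_eq_expect]
  have hg := H (M N) (le_of_max_le_right hMN) g hg0 hg1 (by
    have := (abs_le.1 (hfg.trans (min_le_right _ _))).2
    linarith)
  have := (abs_le.1 (hap.trans (min_le_left _ _))).1
  linarith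

end
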